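/- arXiv:1909.03213 — 16 statements merged into one kernel-verified Lean document; each statement's English description precedes it below -/
import Mathlib

section
/- Fix q' > 0 and e' ∈ (0,1), and let Q' = q'(1+e')/(1−e'). For every (q,ω) with q > 0 and ω ∈ [0,π/2], the minimum of the nodal distance δ_nod(q,e,ω,ω') over (e,ω') ∈ D₁ = [0,1] × [0,π] equals max{0, ℓ^ω_int(q,ω), ℓ^ω_ext(q,ω)}, where ℓ^ω_int(q,ω) = q' − 2q/(1−cos ω) (interpreted as −∞ when ω = 0) and ℓ^ω_ext(q,ω) = q − Q'. -/
open Real Set Filter Topology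

noncomputable section

/-- `a / b` as an extended real, with the convention that it equals `+∞` when `b = 0`. -/
noncomputable def equot (a b : ℝ) : EReal := if b = 0 then ⊤ else ((a / b : ℝ) : EReal)

noncomputable def rplus (q e ω : ℝ) : EReal := equot (q * (1 + e)) (1 + e * Real.cos ω)

noncomputable def rminus (q e ω : ℝ) : EReal := equot (q * (1 + e)) (1 - e * Real.cos ω)

noncomputable def dplus (q' e' q e ω ω' : ℝ) : EReal :=
  equot (q' * (1 + e')) (1 + e' * Real.cos ω') - rplus q e ω

noncomputable def dminus (q' e' q e ω ω' : ℝ) : EReal :=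
  equot (q' * (1 + e')) (1 - e' * Real.cos ω') - rminus q e ω

noncomputable def deltaNod (q' e' q e ω ω' : ℝ) : EReal :=
  min (max (dplus q' e' q e ω ω') (-dplus q' e' q e ω ω'))
      (max (dminus q' e' q e ω ω') (-dminus q' e' q e ω ω'))

noncomputable def deltaInt (q' e' q e ω ω' : ℝ) : EReal :=
  min (dplus q' e' q e ω ω') (dminus q' e' q e ω ω')

noncomputable def deltaExt (q' e' q e ω ω' : ℝ) : EReal :=
  min (-dplus q' e' q e ω ω') (-dminus q' e' q e ω ω')

noncomputable def deltaLink (q' e' q e ω ω' : ℝ) : EReal :=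
  max (min (-dplus q' e' q e ω ω') (dminus q' e' q e ω ω'))
      (min (dplus q' e' q e ω ω') (-dminus q' e' q e ω ω'))


theorem aux_lb (a Q q A : ℝ) (R L : EReal) (h1 : a ≤ A) (h2 : A ≤ Q) (h3 : (q : EReal) ≤ R)
    (h4 : R ≤ L) :
    max 0 (max ((a : EReal) - L) (((q - Q : ℝ) : EReal))) ≤
      max ((A : EReal) - R) (-((A : EReal) - R)) := by
  refine max_le ?_ (max_le ?_ ?_)
  · rcases le_total 0 ((A : EReal) - R) with h | h
    · exact le_max_of_le_left h
    · refine le_max_of_le_right ?_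
      have := EReal.neg_le_neg_iff.2 h
      simpa using this
  · exact le_max_of_le_left (EReal.sub_le_sub (by exact_mod_cast h1) h4)
  · refine le_max_of_le_right ?_
    have h : (A : EReal) - R ≤ ((Q - q : ℝ) : EReal) := by
      rw [EReal.coe_sub]
      exact EReal.sub_le_sub (by exact_mod_cast h2) h3
    have := EReal.neg_le_neg_iff.2 h
    rw [← EReal.coe_neg, neg_sub] at this
    exact this

theorem aux_r (q e c x : ℝ) (hq : 0 < q) (he : e ∈ Icc (0 : ℝ) 1) (hc : c ∈ Icc (0 : ℝ) 1)
    (hx : -c ≤ x) (hx' : x ≤ c) :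
    (q : EReal) ≤ equot (q * (1 + e)) (1 - e * x) ∧
      equot (q * (1 + e)) (1 - e * x) ≤ equot (2 * q) (1 - c) := by
  obtain ⟨he0, he1⟩ := he
  obtain ⟨hc0, hc1⟩ := hc
  have hn : 0 ≤ 1 - e * x := by nlinarith
  unfold equot
  constructor
  · split_ifs with h
    · exact le_top
    · have hp : 0 < 1 - e * x := lt_of_le_of_ne hn (Ne.symm h)
      norm_cast
      rw [le_div_iff₀ hp]
      apply mul_le_mul_of_nonneg_left _ hq.le
      nlinarith
  · by_cases h2 : 1 - c = 0
    · simp [h2]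
    · have hc : 0 < 1 - c := lt_of_le_of_ne (by linarith) (Ne.symm h2)
      have hp : 0 < 1 - e * x := by nlinarith
      rw [if_neg hp.ne', if_neg h2]
      norm_cast
      rw [div_le_div_iff₀ hp hc]
      have : (1 + e) * (1 - c) ≤ 2 * (1 - e * x) := by
        nlinarith [mul_le_mul_of_nonneg_left hx' he0, mul_nonneg (sub_nonneg.2 he1) hc0]
      nlinarith

theorem aux_r' (q' e' x : ℝ) (hq : 0 < q') (he : e' ∈ Ioo (0 : ℝ) 1) 
    (hx : -1 ≤ x) (hx' : x ≤ 1) :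
    equot (q' * (1 + e')) (1 - e' * x) = ((q' * (1 + e') / (1 - e' * x) : ℝ) : EReal) ∧
    q' ≤ q' * (1 + e') / (1 - e' * x) ∧
      q' * (1 + e') / (1 - e' * x) ≤ q' * (1 + e') / (1 - e') := by
  obtain ⟨he0, he1⟩ := he
  have hp : 0 < 1 - e' * x := by nlinarith
  refine ⟨by simp [equot, hp.ne'], ?_, ?_⟩
  · rw [le_div_iff₀ hp]
    apply mul_le_mul_of_nonneg_left _ hq.le
    nlinarith
  · apply div_le_div_of_nonneg_left (by positivity) (by linarith)
    nlinarith

/-- Optimal lower bound for `δ_nod` as a function of `(q, ω)`: the minimum over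
`(e, ω') ∈ [0,1] × [0,π]` equals `max{0, ℓ^ω_int, ℓ^ω_ext}`, where
`ℓ^ω_int = q' - 2q/(1-cos ω)` (which is `-∞` when `ω = 0`) and `ℓ^ω_ext = q - Q'`. -/
theorem deltaNod_min_qom (q' e' : ℝ) (hq' : 0 < q') (he' : e' ∈ Ioo (0 : ℝ) 1)
    (Q' : ℝ) (hQ' : Q' = q' * (1 + e') / (1 - e'))
    (q ω : ℝ) (hq : 0 < q) (hω : ω ∈ Icc 0 (π / 2)) :
    IsLeast ((fun pr : ℝ × ℝ => deltaNod q' e' q pr.1 ω pr.2) '' (Icc 0 1 ×ˢ Icc 0 π))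
      (max 0 (max ((q' : EReal) - equot (2 * q) (1 - Real.cos ω))
        (((q - Q' : ℝ) : EReal)))) := by
  have hc : Real.cos ω ∈ Icc (0 : ℝ) 1 :=
    ⟨Real.cos_nonneg_of_mem_Icc ⟨by linarith [hω.1, Real.pi_pos], hω.2⟩, Real.cos_le_one ω⟩
  have lb : ∀ e ∈ Icc (0 : ℝ) 1, ∀ ω', max 0 (max ((q' : EReal) - equot (2 * q) (1 - Real.cos ω))
        (((q - Q' : ℝ) : EReal))) ≤ deltaNod q' e' q e ω ω' := by
    intro e he ω'
    unfold deltaNod dplus dminus rplus rminus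
    refine le_min ?_ ?_
    · obtain ⟨a1, a2, a3⟩ := aux_r' q' e' (-Real.cos ω') hq' he'
        (by linarith [Real.cos_le_one ω']) (by linarith [Real.neg_one_le_cos ω'])
      obtain ⟨b1, b2⟩ := aux_r q e (Real.cos ω) (-Real.cos ω) hq he hc le_rfl (by linarith [hc.1])
      simp only [mul_neg, sub_neg_eq_add] at a1 a2 a3 b1 b2
      rw [a1]
      exact aux_lb _ _ _ _ _ _ a2 (hQ' ▸ a3) b1 b2
    · obtain ⟨a1, a2, a3⟩ := aux_r' q' e' (Real.cos ω') hq' he'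
        (Real.neg_one_le_cos ω') (Real.cos_le_one ω')
      obtain ⟨b1, b2⟩ := aux_r q e (Real.cos ω) (Real.cos ω) hq he hc (by linarith [hc.1]) le_rfl
      rw [a1]
      exact aux_lb _ _ _ _ _ _ a2 (hQ' ▸ a3) b1 b2
  refine ⟨?_, ?_⟩
  swap
  · rintro _ ⟨⟨e, w⟩, ⟨he, -⟩, rfl⟩
    exact lb e he w
  suffices H : ∃ e ∈ Icc (0 : ℝ) 1, ∃ x ∈ Icc (-1 : ℝ) 1,
      max (equot (q' * (1 + e')) (1 - e' * x) - equot (q * (1 + e)) (1 - e * Real.cos ω))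
       (-(equot (q' * (1 + e')) (1 - e' * x) - equot (q * (1 + e)) (1 - e * Real.cos ω))) ≤
      max 0 (max ((q' : EReal) - equot (2 * q) (1 - Real.cos ω)) (((q - Q' : ℝ) : EReal))) by
    obtain ⟨e, he, x, hx, h⟩ := H
    refine ⟨(e, Real.arccos x), ⟨he, Real.arccos_nonneg x, Real.arccos_le_pi x⟩, ?_⟩
    refine le_antisymm (le_trans (min_le_right _ _) ?_) (lb e he _)
    unfold dminus rminus
    rw [Real.cos_arccos hx.1 hx.2]
    exact h
  obtain ⟨he0, he1⟩ := he'
  obtain ⟨hc0, hc1⟩ := hc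
  generalize Real.cos ω = c at *
  have key : ∀ e x a b : ℝ, 0 < 1 - e' * x → 0 < 1 - e * c → q' * (1 + e') = a * (1 - e' * x) →
      q * (1 + e) = b * (1 - e * c) →
      equot (q' * (1 + e')) (1 - e' * x) - equot (q * (1 + e)) (1 - e * c)
        = ((a - b : ℝ) : EReal) := by
    intro e x a b h1 h2 h3 h4
    rw [equot, equot, if_neg h1.ne', if_neg h2.ne', h3, h4, mul_div_cancel_right₀ _ h1.ne',
      mul_div_cancel_right₀ _ h2.ne', EReal.coe_sub]
  have hQe : q' * (1 + e') = Q' * (1 - e') := by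
    rw [hQ', div_mul_cancel₀ _ (by linarith)]
  by_cases hA : Q' ≤ q
  · refine ⟨0, by simp, 1, by simp, ?_⟩
    rw [key 0 1 Q' q (by linarith) (by simp) (by linarith) (by simp), ← EReal.coe_neg, neg_sub]
    refine le_max_of_le_right (le_max_of_le_right (max_le ?_ le_rfl))
    exact_mod_cast (by linarith : Q' - q ≤ q - Q')
  push Not at hA
  by_cases hB : 2 * q ≤ q' * (1 - c)
  · have hc : 0 < 1 - c := by
      by_contra h
      nlinarith
    refine ⟨1, by simp, -1, by simp, ?_⟩
    have hb : 2 * q / (1 - c) ≤ q' := by rwa [div_le_iff₀ hc]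
    rw [key 1 (-1) q' (2 * q / (1 - c)) (by linarith) (by linarith) (by ring)
      (by rw [one_mul, div_mul_cancel₀ _ hc.ne']; ring), ← EReal.coe_neg, neg_sub]
    refine le_max_of_le_right (le_max_of_le_left ?_)
    rw [equot, if_neg hc.ne', ← EReal.coe_sub]
    refine max_le le_rfl ?_
    exact_mod_cast (by linarith : 2 * q / (1 - c) - q' ≤ q' - 2 * q / (1 - c))
  push Not at hB
  by_cases hC : q' ≤ q
  · have hd : 0 < e' * q := by positivity
    have hx : e' * ((q - q' * (1 + e')) / (e' * q)) * q = q - q' * (1 + e') := by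
      field_simp
    refine ⟨0, by simp, (q - q' * (1 + e')) / (e' * q), ⟨?_, ?_⟩, ?_⟩
    · rw [le_div_iff₀ hd]; nlinarith
    · rw [div_le_iff₀ hd]; nlinarith
    · rw [key 0 _ q q ?_ (by simp) (by linarith) (by simp)]
      · simp
      · by_contra h
        nlinarith [mul_pos hq' he0]
  · push Not at hC
    have hd : 0 < q + q' * c := by positivity
    have he : (q' - q) / (q + q' * c) * (q + q' * c) = q' - q := div_mul_cancel₀ _ hd.ne'
    refine ⟨(q' - q) / (q + q' * c), ⟨div_nonneg (by linarith) hd.le, ?_⟩, -1, by simp, ?_⟩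
    · rw [div_le_one hd]; linarith
    · rw [key _ (-1) q' q' (by linarith) ?_ (by ring) (by linarith)]
      · simp
      · have : (1 - (q' - q) / (q + q' * c) * c) = (q + q * c) / (q + q' * c) := by
          field_simp; ring
        rw [this]; positivity
end
end

section
/- Fix q' > 0 and e' ∈ (0,1), and let p' = q'(1+e'), Q' = q'(1+e')/(1−e'). For every (q,ω) with q > 0 and ω ∈ [0,π/2], the maximum of the nodal distance δ_nod(q,e,ω,ω') over (e,ω') ∈ D₁ = [0,1] × [0,π] equals max{u^ω_int, u^ω_ext, u^ω_link}, where u^ω_int(q,ω) = p' − q; u^ω_ext(q,ω) = min{2q/(1−cos ω) − p'/(1−ξ̂'₊), 2q/(1+cos ω) − q'} with ξ̂'₊ = min{ξ'₊, e'} and ξ'₊ = 4q·cos ω / (p'·sin²ω + √(p'²·sin⁴ω + 16 q²·cos²ω)); and u^ω_link(q,ω) = min{Q' − q(1+ê₊)/(1+ê₊·cos ω), 2q/(1−cos ω) − q'} (the second term interpreted as +∞ when ω = 0) with ê₊ = max{0, min{e₊, 1}} and e₊ = 2(p' − q(1−e'²)) / (q(1−e'²) + √(q²(1−e'²)² + 4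 p'·cos²ω·(p' − q(1−e'²)))). -/
open Real Set Filter Topology

noncomputable section

noncomputable def xiStar (p' q ω : ℝ) : ℝ :=
  4 * q * Real.cos ω /
    (p' * Real.sin ω ^ 2 + Real.sqrt (p' ^ 2 * Real.sin ω ^ 4 + 16 * q ^ 2 * Real.cos ω ^ 2))

noncomputable def eStar (p' e' q ω : ℝ) : ℝ :=
  2 * (p' - q * (1 - e' ^ 2)) /
    (q * (1 - e' ^ 2) +
      Real.sqrt (q ^ 2 * (1 - e' ^ 2) ^ 2 + 4 * p' * Real.cos ω ^ 2 * (p' - q * (1 - e' ^ 2))))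

noncomputable def eHat (p' e' q ω : ℝ) : ℝ := max 0 (min (eStar p' e' q ω) 1)

/-- The upper bound `u^ω_ext`, with `2q/(1-cos ω)` read as `+∞` when `ω = 0`. -/
noncomputable def uExtOm (q' e' p' q ω : ℝ) : EReal :=
  min (equot (2 * q) (1 - Real.cos ω) - ((p' / (1 - min (xiStar p' q ω) e') : ℝ) : EReal))
      (((2 * q / (1 + Real.cos ω) - q' : ℝ) : EReal))

/-- The upper bound `u^ω_link`, with `2q/(1-cos ω)` read as `+∞` when `ω = 0`. -/
noncomputable def uLinkOm (q' e' p' Q' q ω : ℝ) : EReal :=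
  min (((Q' - q * (1 + eHat p' e' q ω) / (1 + eHat p' e' q ω * Real.cos ω) : ℝ) : EReal))
      (equot (2 * q) (1 - Real.cos ω) - ((q' : ℝ) : EReal))

lemma quad_aux (k m n e r D : ℝ) (hk : 0 ≤ k) (hm : 0 ≤ m) (hn : 0 ≤ n)
    (hD : D = Real.sqrt (m ^ 2 + 4 * k * n)) (hpos : 0 < m + D) (hr : r = 2 * n / (m + D)) :
    0 ≤ r ∧ k * r ^ 2 + m * r = n ∧
    (0 ≤ e → e ≤ r → k * e ^ 2 + m * e ≤ n) ∧ (r ≤ e → n ≤ k * e ^ 2 + m * e) := by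
  have hr0 : 0 ≤ r := by rw [hr]; positivity
  have h1 : r * (m + D) = 2 * n := by rw [hr]; field_simp
  have hD2 : D ^ 2 = m ^ 2 + 4 * k * n := by rw [hD]; exact Real.sq_sqrt (by positivity)
  have h2 : 2 * k * r = D - m := by
    have : (m + D) * (2 * k * r - (D - m)) = 0 := by
      linear_combination (2 * k) * h1 - hD2
    rcases mul_eq_zero.mp this with h | h <;> linarith
  have h3 : k * r ^ 2 + m * r = n := by
    linear_combination (1 / 2) * h1 + (r / 2) * h2
  refine ⟨hr0, h3, fun he her => ?_, fun her => ?_⟩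
  · rw [← h3]; gcongr
  · rw [← h3]; gcongr

lemma deltaNod_eq (q' e' q e ω ω' : ℝ) (hq : 0 < q) (he' : e' ∈ Ioo (0 : ℝ) 1)
    (he : e ∈ Icc (0:ℝ) 1) (hc : 0 ≤ Real.cos ω) (x : ℝ) (hx : x = e' * Real.cos ω') :
    x ∈ Icc (-e') e' ∧ deltaNod q' e' q e ω ω' =
    min (max ((q' * (1 + e') / (1 + x) - q * (1 + e) / (1 + e * Real.cos ω) : ℝ) : EReal)
          ((q * (1 + e) / (1 + e * Real.cos ω) - q' * (1 + e') / (1 + x) : ℝ) : EReal))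
      (max (((q' * (1 + e') / (1 - x) : ℝ) : EReal) - rminus q e ω)
        (rminus q e ω - ((q' * (1 + e') / (1 - x) : ℝ) : EReal))) := by
  obtain ⟨h0, h1⟩ := he'
  obtain ⟨h2, h3⟩ := he
  have hx1 : -e' ≤ x := by rw [hx]; nlinarith [Real.neg_one_le_cos ω']
  have hx2 : x ≤ e' := by rw [hx]; nlinarith [Real.cos_le_one ω']
  refine ⟨⟨hx1, hx2⟩, ?_⟩
  have ha : (1 + x) ≠ 0 := by linarith
  have hb : (1 - x) ≠ 0 := by linarith
  have hcc : 1 + e * Real.cos ω ≠ 0 := by positivity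
  unfold deltaNod dplus dminus
  rw [← hx]
  have e1 : equot (q' * (1 + e')) (1 + x) = ((q' * (1 + e') / (1 + x) : ℝ) : EReal) := if_neg ha
  have e2 : equot (q' * (1 + e')) (1 - x) = ((q' * (1 + e') / (1 - x) : ℝ) : EReal) := if_neg hb
  have e3 : rplus q e ω = ((q * (1 + e) / (1 + e * Real.cos ω) : ℝ) : EReal) := if_neg hcc
  rw [e1, e2, e3]
  congr 2
  · rw [← EReal.coe_sub, ← EReal.coe_neg]; congr 1; ring
  · rw [EReal.neg_sub (Or.inl (EReal.coe_ne_bot _)) (Or.inl (EReal.coe_ne_top _)), add_comm]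
    exact (sub_eq_add_neg _ _).symm

lemma div_mono_aux (q c e f : ℝ) (hq : 0 < q) (hc : 0 ≤ c) (hc1 : c ≤ 1) (he : 0 ≤ e)
    (hef : e ≤ f) : q * (1 + e) / (1 + e * c) ≤ q * (1 + f) / (1 + f * c) := by
  have : 0 ≤ f := he.trans hef
  rw [div_le_div_iff₀ (by positivity) (by positivity)]
  have : 0 ≤ q * ((f - e) * (1 - c)) :=
    mul_nonneg hq.le (mul_nonneg (by linarith) (by linarith))
  nlinarith

lemma rminus_mono (q ω e f : ℝ) (hq : 0 < q) (hc : 0 ≤ Real.cos ω) (he : 0 ≤ e)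
    (hef : e ≤ f) (hf : f ≤ 1) : rminus q e ω ≤ rminus q f ω := by
  unfold rminus equot
  have hc1 := Real.cos_le_one ω
  by_cases h : 1 - f * Real.cos ω = 0
  · rw [if_pos h]; exact le_top
  · have h1 : 0 < 1 - f * Real.cos ω := lt_of_le_of_ne (by nlinarith) (Ne.symm h)
    have h2 : 1 - f * Real.cos ω ≤ 1 - e * Real.cos ω := by
      have := mul_le_mul_of_nonneg_right hef hc
      linarith
    rw [if_neg h, if_neg (by linarith)]
    rw [EReal.coe_le_coe_iff]
    have : 0 ≤ f := he.trans hef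
    apply div_le_div₀ (by positivity) (by gcongr) h1 h2

lemma rminus_ne_bot (q e ω : ℝ) : rminus q e ω ≠ ⊥ := by
  unfold rminus equot
  split_ifs
  · exact top_ne_bot
  · exact EReal.coe_ne_bot _

lemma equot_eq (q ω : ℝ) : equot (2 * q) (1 - Real.cos ω) = rminus q 1 ω := by
  unfold rminus; congr 1 <;> ring

/-- comparison at the external configuration -/
lemma ext_key (p q ω x : ℝ) (hp : 0 < p) (hq : 0 < q) (hω : ω ∈ Icc 0 (π / 2)) (hx1 : x < 1)
    (hx0 : 0 ≤ x) :
    0 ≤ xiStar p q ω ∧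
    (x ≤ xiStar p q ω → ((2 * q / (1 + Real.cos ω) - p / (1 + x) : ℝ) : EReal) ≤
      rminus q 1 ω - ((p / (1 - x) : ℝ) : EReal)) ∧
    (xiStar p q ω ≤ x → rminus q 1 ω - ((p / (1 - x) : ℝ) : EReal) ≤
      ((2 * q / (1 + Real.cos ω) - p / (1 + x) : ℝ) : EReal)) := by
  have hc : 0 ≤ Real.cos ω := Real.cos_nonneg_of_mem_Icc ⟨by linarith [hω.1, Real.pi_pos], hω.2⟩
  have hc1 := Real.cos_le_one ω
  set c := Real.cos ω with hcdef
  have hs : Real.sin ω ^ 2 = 1 - c ^ 2 := Real.sin_sq ω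
  have hsp : 0 ≤ Real.sin ω ^ 2 := sq_nonneg _
  set D := Real.sqrt ((p * Real.sin ω ^ 2) ^ 2 + 4 * (2 * q * c) * (2 * q * c)) with hD
  have hpos : 0 < p * Real.sin ω ^ 2 + D := by
    rcases hc.eq_or_lt with h | h
    · have : 0 < p * Real.sin ω ^ 2 := by rw [hs, ← h]; simpa using hp
      have := Real.sqrt_nonneg ((p * Real.sin ω ^ 2) ^ 2 + 4 * (2 * q * c) * (2 * q * c))
      linarith
    · have : 0 < D := Real.sqrt_pos.mpr (by positivity)
      positivity
  have hxi : xiStar p q ω = 2 * (2 * q * c) / (p * Real.sin ω ^ 2 + D) := by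
    unfold xiStar
    rw [hD, ← hcdef]
    congr 1
    · ring
    · congr 2; ring
  obtain ⟨h0, h1, h2, h3⟩ := quad_aux (2 * q * c) (p * Real.sin ω ^ 2) (2 * q * c) x
    (xiStar p q ω) D (by positivity) (by positivity) (by positivity) hD hpos hxi
  refine ⟨h0, ?_⟩
  rw [hs] at h1 h2 h3
  have hrm : rminus q 1 ω = equot (2 * q) (1 - c) := (equot_eq q ω).symm
  by_cases hc2 : c = 1
  · rw [hrm, equot, if_pos (by linarith), EReal.top_sub_coe]
    refine ⟨fun _ => le_top, fun h => ?_⟩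
    exfalso
    rw [hc2] at h1
    have : (xiStar p q ω) ^ 2 = 1 := by
      have : 2 * q * (xiStar p q ω ^ 2 - 1) = 0 := by linear_combination h1
      rcases mul_eq_zero.mp this with h | h <;> linarith
    nlinarith
  · have hc3 : c < 1 := lt_of_le_of_ne hc1 hc2
    have hb : 0 < 1 - c := by linarith
    have hx2 : 0 < 1 - x := by linarith
    have hid : (2 * q / (1 - c) - p / (1 - x)) - (2 * q / (1 + c) - p / (1 + x)) =
      2 * (2 * q * c - (2 * q * c * x ^ 2 + p * (1 - c ^ 2) * x)) /
        ((1 - c) * (1 + c) * ((1 - x) * (1 + x))) := by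
      have : 1 + c ≠ 0 := by positivity
      have : 1 + x ≠ 0 := by positivity
      field_simp
      ring
    have hden : 0 < (1 - c) * (1 + c) * ((1 - x) * (1 + x)) := by positivity
    rw [hrm, equot, if_neg hb.ne', ← EReal.coe_sub, EReal.coe_le_coe_iff, EReal.coe_le_coe_iff]
    refine ⟨fun h => ?_, fun h => ?_⟩
    · have := div_nonneg (by linarith [h2 hx0 h] :
        0 ≤ 2 * (2 * q * c - (2 * q * c * x ^ 2 + p * (1 - c ^ 2) * x))) hden.le
      linarith
    · have := div_nonpos_of_nonpos_of_nonneg (by linarith [h3 h] :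
        2 * (2 * q * c - (2 * q * c * x ^ 2 + p * (1 - c ^ 2) * x)) ≤ 0) hden.le
      linarith

/-- comparison at the linked configuration -/
lemma link_key (q' e' q ω e : ℝ) (hq' : 0 < q') (hq : 0 < q) (he' : e' ∈ Ioo (0 : ℝ) 1)
    (hc : 0 ≤ Real.cos ω) (he0 : 0 ≤ e) (he1 : e ≤ 1) :
    (e ≤ eStar (q' * (1 + e')) e' q ω → rminus q e ω - (q' : EReal) ≤
      ((q' * (1 + e') / (1 - e') - q * (1 + e) / (1 + e * Real.cos ω) : ℝ) : EReal)) ∧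
    (eStar (q' * (1 + e')) e' q ω ≤ e →
      ((q' * (1 + e') / (1 - e') - q * (1 + e) / (1 + e * Real.cos ω) : ℝ) : EReal) ≤
      rminus q e ω - (q' : EReal)) := by
  obtain ⟨h0, h1⟩ := he'
  have hc1 := Real.cos_le_one ω
  set c := Real.cos ω with hcdef
  set p := q' * (1 + e') with hp
  have hp0 : 0 < p := by positivity
  have hE : 0 < 1 - e' ^ 2 := by nlinarith
  set m := q * (1 - e' ^ 2) with hm
  have hm0 : 0 < m := by positivity
  set D := Real.sqrt (m ^ 2 + 4 * (p * c ^ 2) * (p - m)) with hD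
  have hD0 : 0 ≤ D := Real.sqrt_nonneg _
  have hes : eStar p e' q ω = 2 * (p - m) / (m + D) := by
    unfold eStar
    rw [hD, ← hcdef, ← hm]
    congr 3; rw [hm]; ring
  have key : (e ≤ eStar p e' q ω → p * c ^ 2 * e ^ 2 + m * e ≤ p - m) ∧
      (eStar p e' q ω ≤ e → p - m ≤ p * c ^ 2 * e ^ 2 + m * e) := by
    rcases le_or_gt m p with h | h
    · obtain ⟨_, _, h2, h3⟩ := quad_aux (p * c ^ 2) m (p - m) e (eStar p e' q ω) D (by positivity)
        hm0.le (by linarith) hD (by positivity) hes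
      exact ⟨h2 he0, h3⟩
    · have : eStar p e' q ω < 0 := by
        rw [hes]; exact div_neg_of_neg_of_pos (by linarith) (by positivity)
      refine ⟨fun h => by linarith, fun _ => ?_⟩
      have : 0 ≤ p * c ^ 2 * e ^ 2 + m * e := by positivity
      linarith
  have hrm : rminus q e ω = equot (q * (1 + e)) (1 - e * c) := rfl
  have hec : e * c ≤ 1 := by nlinarith
  by_cases hz : 1 - e * c = 0
  · rw [hrm, equot, if_pos hz, EReal.top_sub_coe]
    refine ⟨fun h => ?_, fun h => le_top⟩
    exfalso
    have := key.1 h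
    have h4 : e * c = 1 := by linarith
    have : p * c ^ 2 * e ^ 2 = p := by
      have : p * c ^ 2 * e ^ 2 = p * (e * c) ^ 2 := by ring
      rw [this, h4]; ring
    have : 0 ≤ m * e := by positivity
    linarith
  · have hz' : 0 < 1 - e * c := lt_of_le_of_ne (by linarith) (Ne.symm hz)
    have h1' : 0 < 1 - e' := by linarith
    have hid : (p / (1 - e') - q * (1 + e) / (1 + e * c)) - (q * (1 + e) / (1 - e * c) - q') =
      2 * (p - m - (p * c ^ 2 * e ^ 2 + m * e)) /
        ((1 - e' ^ 2) * ((1 - e * c) * (1 + e * c))) := by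
      have : 1 + e * c ≠ 0 := by positivity
      rw [hm, hp]
      field_simp
      ring
    have hden : 0 < (1 - e' ^ 2) * ((1 - e * c) * (1 + e * c)) := by positivity
    rw [hrm, equot, if_neg hz, ← EReal.coe_sub, EReal.coe_le_coe_iff, EReal.coe_le_coe_iff]
    refine ⟨fun h => ?_, fun h => ?_⟩
    · have := div_nonneg (by linarith [key.1 h] :
        0 ≤ 2 * (p - m - (p * c ^ 2 * e ^ 2 + m * e))) hden.le
      linarith
    · have := div_nonpos_of_nonpos_of_nonneg (by linarith [key.2 h] :
        2 * (p - m - (p * c ^ 2 * e ^ 2 + m * e)) ≤ 0) hden.le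
      linarith

lemma coe_le_rminus (q e ω : ℝ) (hq : 0 < q) (he : 0 ≤ e) (he1 : e ≤ 1) (hc : 0 ≤ Real.cos ω) :
    ((q * (1 + e) / (1 + e * Real.cos ω) : ℝ) : EReal) ≤ rminus q e ω := by
  have hc1 := Real.cos_le_one ω
  unfold rminus equot
  by_cases h : 1 - e * Real.cos ω = 0
  · rw [if_pos h]; exact le_top
  · have h1 : 0 < 1 - e * Real.cos ω := lt_of_le_of_ne (by nlinarith) (Ne.symm h)
    rw [if_neg h, EReal.coe_le_coe_iff]
    have : 0 ≤ e * Real.cos ω := by positivity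
    gcongr
    linarith

lemma upper_aux (q' e' : ℝ) (hq' : 0 < q') (he' : e' ∈ Ioo (0 : ℝ) 1)
    (q ω : ℝ) (hq : 0 < q) (hω : ω ∈ Icc 0 (π / 2)) (e ω' : ℝ) (he : e ∈ Icc (0:ℝ) 1) :
    deltaNod q' e' q e ω ω' ≤ (max (((q' * (1 + e') - q : ℝ) : EReal))
        (max (uExtOm q' e' (q' * (1 + e')) q ω)
          (uLinkOm q' e' (q' * (1 + e')) (q' * (1 + e') / (1 - e')) q ω))) := by
  have hc : 0 ≤ Real.cos ω := Real.cos_nonneg_of_mem_Icc ⟨by linarith [hω.1, Real.pi_pos], hω.2⟩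
  have hc1 := Real.cos_le_one ω
  obtain ⟨⟨hx1, hx2⟩, hd⟩ := deltaNod_eq q' e' q e ω ω' hq he' he hc _ rfl
  rw [hd]
  clear hd
  generalize e' * Real.cos ω' = x at *
  have h0 := he'.1
  have h1 := he'.2
  obtain ⟨g0, g1⟩ := he
  have hp0 : 0 < q' * (1 + e') := by positivity
  have hqq : q' = q' * (1 + e') / (1 + e') := by field_simp
  -- basic bounds
  have hA : q' ≤ q' * (1 + e') / (1 + x) := by
    rw [le_div_iff₀ (by linarith)]; gcongr
  have hB : q' ≤ q' * (1 + e') / (1 - x) := by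
    rw [le_div_iff₀ (by linarith)]; gcongr; linarith
  have hA' : q' * (1 + e') / (1 + x) ≤ q' * (1 + e') / (1 - e') := by
    apply div_le_div_of_nonneg_left hp0.le <;> linarith
  have hB' : q' * (1 + e') / (1 - x) ≤ q' * (1 + e') / (1 - e') := by
    apply div_le_div_of_nonneg_left hp0.le <;> linarith
  have hR0 : q ≤ q * (1 + e) / (1 + e * Real.cos ω) := by
    simpa using div_mono_aux q _ 0 e hq hc hc1 le_rfl g0
  have hR1 : q * (1 + e) / (1 + e * Real.cos ω) ≤ 2 * q / (1 + Real.cos ω) := by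
    have := div_mono_aux q _ e 1 hq hc hc1 g0 g1
    rw [one_mul] at this
    convert this using 2; ring
  have hS1 := rminus_mono q ω e 1 hq hc g0 g1 le_rfl
  have hSR := coe_le_rminus q e ω hq g0 g1 hc
  have hS0 : (q : EReal) ≤ rminus q e ω := le_trans (EReal.coe_le_coe_iff.mpr hR0) hSR
  -- link bound
  have hlink : min ((q' * (1 + e') / (1 - e') - q * (1 + e) / (1 + e * Real.cos ω) : ℝ) : EReal)
      (rminus q e ω - (q' : EReal)) ≤
      uLinkOm q' e' (q' * (1 + e')) (q' * (1 + e') / (1 - e')) q ω := by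
    unfold uLinkOm
    rw [equot_eq]
    refine le_min ?_ ((min_le_right _ _).trans (EReal.sub_le_sub hS1 le_rfl))
    set E := eHat (q' * (1 + e')) e' q ω with hE
    have hE0 : 0 ≤ E := le_max_left _ _
    have hE1 : E ≤ 1 := max_le zero_le_one (min_le_right _ _)
    rcases le_or_gt E e with h | h
    · refine (min_le_left _ _).trans ?_
      rw [EReal.coe_le_coe_iff]
      linarith [div_mono_aux q _ E e hq hc hc1 hE0 h]
    · have hEs : E ≤ eStar (q' * (1 + e')) e' q ω := by
        rw [hE, eHat]
        rcases le_or_gt (min (eStar (q' * (1 + e')) e' q ω) 1) 0 with h' | h'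
        · have : E = 0 := max_eq_left h'
          linarith
        · rw [max_eq_right h'.le]; exact min_le_left _ _
      refine (min_le_right _ _).trans (le_trans ?_
        ((link_key q' e' q ω E hq' hq he' hc hE0 hE1).1 hEs))
      exact EReal.sub_le_sub (rminus_mono q ω e E hq hc g0 h.le hE1) le_rfl
  have hlink1 : min ((q' * (1 + e') / (1 + x) - q * (1 + e) / (1 + e * Real.cos ω) : ℝ) : EReal)
      (rminus q e ω - ((q' * (1 + e') / (1 - x) : ℝ) : EReal)) ≤
      uLinkOm q' e' (q' * (1 + e')) (q' * (1 + e') / (1 - e')) q ω := by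
    refine le_trans (min_le_min ?_ ?_) hlink
    · rw [EReal.coe_le_coe_iff]; linarith
    · exact EReal.sub_le_sub le_rfl (EReal.coe_le_coe_iff.mpr hB)
  have hlink2 : min ((q * (1 + e) / (1 + e * Real.cos ω) - q' * (1 + e') / (1 + x) : ℝ) : EReal)
      (((q' * (1 + e') / (1 - x) : ℝ) : EReal) - rminus q e ω) ≤
      uLinkOm q' e' (q' * (1 + e')) (q' * (1 + e') / (1 - e')) q ω := by
    rw [min_comm]
    refine le_trans (min_le_min ?_ ?_) hlink
    · rw [EReal.coe_sub]
      exact EReal.sub_le_sub (EReal.coe_le_coe_iff.mpr hB') hSR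
    · rw [EReal.coe_sub]
      exact EReal.sub_le_sub hSR (EReal.coe_le_coe_iff.mpr hA)
  have hint : min ((q' * (1 + e') / (1 + x) - q * (1 + e) / (1 + e * Real.cos ω) : ℝ) : EReal)
      (((q' * (1 + e') / (1 - x) : ℝ) : EReal) - rminus q e ω) ≤
      ((q' * (1 + e') - q : ℝ) : EReal) := by
    rcases le_total 0 x with h | h
    · refine (min_le_left _ _).trans ?_
      rw [EReal.coe_le_coe_iff]
      have : q' * (1 + e') / (1 + x) ≤ q' * (1 + e') := div_le_self hp0.le (by linarith)
      linarith
    · refine (min_le_right _ _).trans ?_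
      have : q' * (1 + e') / (1 - x) ≤ q' * (1 + e') := div_le_self hp0.le (by linarith)
      rw [EReal.coe_sub]
      exact EReal.sub_le_sub (EReal.coe_le_coe_iff.mpr this) hS0
  have hext : min ((q * (1 + e) / (1 + e * Real.cos ω) - q' * (1 + e') / (1 + x) : ℝ) : EReal)
      (rminus q e ω - ((q' * (1 + e') / (1 - x) : ℝ) : EReal)) ≤
      uExtOm q' e' (q' * (1 + e')) q ω := by
    unfold uExtOm
    rw [equot_eq]
    refine le_min ?_ ((min_le_left _ _).trans (by rw [EReal.coe_le_coe_iff]; linarith))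
    have hxi0 := (ext_key (q' * (1 + e')) q ω 0 hp0 hq hω one_pos le_rfl).1
    set X := min (xiStar (q' * (1 + e')) q ω) e' with hX
    have hX0 : 0 ≤ X := le_min hxi0 h0.le
    have hX1 : X ≤ e' := min_le_right _ _
    rcases le_total X x with h | h
    · refine (min_le_right _ _).trans (EReal.sub_le_sub hS1 (EReal.coe_le_coe_iff.mpr ?_))
      apply div_le_div_of_nonneg_left hp0.le <;> linarith
    · refine (min_le_left _ _).trans (le_trans ?_
        ((ext_key (q' * (1 + e')) q ω X hp0 hq hω (by linarith) hX0).2.1 (min_le_left _ _)))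
      rw [EReal.coe_le_coe_iff]
      have : q' * (1 + e') / (1 + X) ≤ q' * (1 + e') / (1 + x) := by
        apply div_le_div_of_nonneg_left hp0.le <;> linarith
      linarith
  rw [min_max_distrib_left, min_max_distrib_right, min_max_distrib_right]
  refine max_le (max_le ?_ ?_) (max_le ?_ ?_)
  · exact hint.trans (le_max_left _ _)
  · exact hlink2.trans ((le_max_right _ _).trans (le_max_right _ _))
  · exact hlink1.trans ((le_max_right _ _).trans (le_max_right _ _))
  · exact hext.trans ((le_max_left _ _).trans (le_max_right _ _))

lemma lower_aux (q' e' : ℝ) (hq' : 0 < q') (he' : e' ∈ Ioo (0 : ℝ) 1)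
    (q ω : ℝ) (hq : 0 < q) (hω : ω ∈ Icc 0 (π / 2)) (M : EReal)
    (hM : M = ((q' * (1 + e') - q : ℝ) : EReal) ∨ M = uExtOm q' e' (q' * (1 + e')) q ω ∨
      M = uLinkOm q' e' (q' * (1 + e')) (q' * (1 + e') / (1 - e')) q ω) :
    ∃ e ∈ Icc (0:ℝ) 1, ∃ ω' ∈ Icc 0 π, M ≤ deltaNod q' e' q e ω ω' := by
  have hc : 0 ≤ Real.cos ω := Real.cos_nonneg_of_mem_Icc ⟨by linarith [hω.1, Real.pi_pos], hω.2⟩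
  have hc1 := Real.cos_le_one ω
  have h0 := he'.1
  have h1 := he'.2
  have hp0 : 0 < q' * (1 + e') := by positivity
  have hqq : q' * (1 + e') / (1 + e') = q' := by field_simp
  -- reduce to a choice of `x`
  suffices H : ∃ e ∈ Icc (0:ℝ) 1, ∃ x ∈ Icc (-e') e', M ≤
    min (max ((q' * (1 + e') / (1 + x) - q * (1 + e) / (1 + e * Real.cos ω) : ℝ) : EReal)
          ((q * (1 + e) / (1 + e * Real.cos ω) - q' * (1 + e') / (1 + x) : ℝ) : EReal))
      (max (((q' * (1 + e') / (1 - x) : ℝ) : EReal) - rminus q e ω)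
        (rminus q e ω - ((q' * (1 + e') / (1 - x) : ℝ) : EReal))) by
    obtain ⟨e, he, x, hx, h⟩ := H
    refine ⟨e, he, Real.arccos (x / e'), ⟨Real.arccos_nonneg _, Real.arccos_le_pi _⟩, ?_⟩
    have hxx : x = e' * Real.cos (Real.arccos (x / e')) := by
      rw [Real.cos_arccos]
      · field_simp
      · rw [le_div_iff₀ h0]; linarith [hx.1]
      · rw [div_le_iff₀ h0]; linarith [hx.2]
    rw [(deltaNod_eq q' e' q e ω _ hq he' he hc x hxx).2]
    exact h
  rcases hM with hM | hM | hM
  · refine ⟨0, by simp, 0, by simp [h0.le], ?_⟩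
    have : rminus q 0 ω = (q : EReal) := by simp [rminus, equot]
    rw [hM, this]
    refine le_min (le_max_of_le_left ?_) (le_max_of_le_left ?_)
    · simp
    · simp
  · have hxi0 := (ext_key (q' * (1 + e')) q ω 0 hp0 hq hω one_pos le_rfl).1
    rw [hM]
    unfold uExtOm
    rw [equot_eq]
    set X := min (xiStar (q' * (1 + e')) q ω) e' with hX
    have hX0 : 0 ≤ X := le_min hxi0 h0.le
    have hX1 : X ≤ e' := min_le_right _ _
    refine ⟨1, by simp, X, ⟨by linarith, hX1⟩, ?_⟩
    refine le_min (le_max_of_le_right ?_) (le_max_of_le_right (min_le_left _ _))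
    have hr : q * (1 + 1) / (1 + 1 * Real.cos ω) = 2 * q / (1 + Real.cos ω) := by
      rw [one_mul]; congr 1; ring
    rw [hr]
    rcases le_total (xiStar (q' * (1 + e')) q ω) e' with h | h
    · have : X = xiStar (q' * (1 + e')) q ω := min_eq_left h
      exact (min_le_left _ _).trans
        ((ext_key (q' * (1 + e')) q ω X hp0 hq hω (by linarith) hX0).2.2 this.ge)
    · have : X = e' := min_eq_right h
      rw [this, hqq]
      exact min_le_right _ _
  · rw [hM]
    unfold uLinkOm
    rw [equot_eq]
    set E := eHat (q' * (1 + e')) e' q ω with hE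
    have hE0 : 0 ≤ E := le_max_left _ _
    have hE1 : E ≤ 1 := max_le zero_le_one (min_le_right _ _)
    refine ⟨E, ⟨hE0, hE1⟩, -e', ⟨le_rfl, by linarith⟩, ?_⟩
    rw [sub_neg_eq_add, hqq, ← sub_eq_add_neg]
    refine le_min (le_max_of_le_left (min_le_left _ _)) (le_max_of_le_right ?_)
    rcases hE1.eq_or_lt with h | h
    · rw [h]; exact min_le_right _ _
    · refine (min_le_left _ _).trans ((link_key q' e' q ω E hq' hq he' hc hE0 hE1).2 ?_)
      by_contra hcon
      push Not at hcon
      have : min (eStar (q' * (1 + e')) e' q ω) 1 ≤ E := le_max_right _ _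
      rcases min_le_iff.mp this with h' | h' <;> linarith

/-- Optimal upper bound for `δ_nod` as a function of `(q, ω)`: the maximum over
`(e, ω') ∈ [0,1] × [0,π]` equals `max{u^ω_int, u^ω_ext, u^ω_link}`. -/
theorem deltaNod_max_qom (q' e' : ℝ) (hq' : 0 < q') (he' : e' ∈ Ioo (0 : ℝ) 1)
    (p' Q' : ℝ) (hp' : p' = q' * (1 + e')) (hQ' : Q' = q' * (1 + e') / (1 - e'))
    (q ω : ℝ) (hq : 0 < q) (hω : ω ∈ Icc 0 (π / 2)) :
    IsGreatest ((fun pr : ℝ × ℝ => deltaNod q' e' q pr.1 ω pr.2) '' (Icc 0 1 ×ˢ Icc 0 π))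
      (max (((p' - q : ℝ) : EReal))
        (max (uExtOm q' e' p' q ω) (uLinkOm q' e' p' Q' q ω))) := by
  subst hp' hQ'
  constructor
  · obtain ⟨e, he, ω', hω', h⟩ := lower_aux q' e' hq' he' q ω hq hω
      (max (((q' * (1 + e') - q : ℝ) : EReal))
        (max (uExtOm q' e' (q' * (1 + e')) q ω)
          (uLinkOm q' e' (q' * (1 + e')) (q' * (1 + e') / (1 - e')) q ω))) (by
        rcases max_choice (((q' * (1 + e') - q : ℝ) : EReal))
          (max (uExtOm q' e' (q' * (1 + e')) q ω)
          (uLinkOm q' e' (q' * (1 + e')) (q' * (1 + e') / (1 - e')) q ω)) with h | h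
        · exact Or.inl h
        · rw [h]; exact Or.inr (max_choice _ _))
    exact ⟨(e, ω'), ⟨he, hω'⟩, le_antisymm (upper_aux q' e' hq' he' q ω hq hω e ω' he) h⟩
  · rintro _ ⟨⟨e, ω'⟩, ⟨he, hω'⟩, rfl⟩
    exact upper_aux q' e' hq' he' q ω hq hω e ω' he
end
end

section
/- Fix q' > 0 and e' ∈ (0,1), and let Q' = q'(1+e')/(1−e'). For every q > 0, ω ∈ [0,π/2], e ∈ [0,1] and ω' ∈ [0,π]: δ_int(q,e,ω,ω') ≥ δ_int(q,1,ω,π) = q' − 2q/(1−cos ω), and δ_ext(q,e,ω,ω') ≥ δ_ext(q,0,ω,π) = q − Q'. -/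
open Real Set Filter Topology

noncomputable section

theorem aux_low (q e x : ℝ) (hq : 0 < q) (h0 : 0 ≤ e) (hx : x ≤ 1) (hx' : 0 ≤ 1 + e * x) :
    (q : EReal) ≤ equot (q * (1 + e)) (1 + e * x) := by
  unfold equot
  split_ifs with h
  · exact le_top
  · have hp : 0 < 1 + e * x := lt_of_le_of_ne hx' (Ne.symm h)
    rw [EReal.coe_le_coe_iff, le_div_iff₀ hp]
    have : e * x ≤ e * 1 := mul_le_mul_of_nonneg_left hx h0
    exact mul_le_mul_of_nonneg_left (by linarith) hq.le

theorem aux_up (q e x : ℝ) (hq : 0 < q) (h0 : 0 ≤ e) (h1 : e < 1) (hx : -1 ≤ x) :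
    equot (q * (1 + e)) (1 + e * x) ≤ ((q * (1 + e) / (1 - e) : ℝ) : EReal) := by
  have h : e * (-1) ≤ e * x := mul_le_mul_of_nonneg_left hx h0
  have hp : 0 < 1 + e * x := by linarith
  unfold equot
  rw [if_neg hp.ne', EReal.coe_le_coe_iff]
  have h2 : 0 < 1 - e := by linarith
  exact div_le_div_of_nonneg_left (by positivity) h2 (by linarith)

theorem aux_up2 (q e c x : ℝ) (hq : 0 < q) (h0 : 0 ≤ e) (h1 : e ≤ 1) (hc0 : 0 ≤ c) (hc : c ≤ 1)
    (hx : -c ≤ x) : equot (q * (1 + e)) (1 + e * x) ≤ equot (2 * q) (1 - c) := by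
  unfold equot
  by_cases h : 1 - c = 0
  · rw [if_pos h]; exact le_top
  · have hp : 0 < 1 - c := lt_of_le_of_ne (by linarith) (Ne.symm h)
    have h3 : e * (-c) ≤ e * x := mul_le_mul_of_nonneg_left hx h0
    have h4 : e * c ≤ 1 * c := mul_le_mul_of_nonneg_right h1 hc0
    have hp2 : 0 < 1 + e * x := by linarith
    rw [if_neg h, if_neg hp2.ne', EReal.coe_le_coe_iff, div_le_div_iff₀ hp2 hp]
    have h5 : (1 + e) * (1 - c) ≤ 2 * (1 + e * x) := by nlinarith
    nlinarith [mul_le_mul_of_nonneg_left h5 hq.le]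

/-- Lower bounds: `δ_int(q,e,ω,ω') ≥ δ_int(q,1,ω,π) = q' - 2q/(1-cos ω)` and
`δ_ext(q,e,ω,ω') ≥ δ_ext(q,0,ω,π) = q - Q'`. -/
theorem deltaInt_deltaExt_lower_bounds_qom (q' e' : ℝ) (hq' : 0 < q')
    (he' : e' ∈ Ioo (0 : ℝ) 1) (Q' : ℝ) (hQ' : Q' = q' * (1 + e') / (1 - e'))
    (q ω : ℝ) (hq : 0 < q) (hω : ω ∈ Icc 0 (π / 2)) :
    (∀ e ∈ Icc (0 : ℝ) 1, ∀ ω' ∈ Icc (0 : ℝ) π,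
      deltaInt q' e' q 1 ω π ≤ deltaInt q' e' q e ω ω') ∧
    deltaInt q' e' q 1 ω π = (q' : EReal) - equot (2 * q) (1 - Real.cos ω) ∧
    (∀ e ∈ Icc (0 : ℝ) 1, ∀ ω' ∈ Icc (0 : ℝ) π,
      deltaExt q' e' q 0 ω π ≤ deltaExt q' e' q e ω ω') ∧
    deltaExt q' e' q 0 ω π = ((q - Q' : ℝ) : EReal) := by
  obtain ⟨he0, he1⟩ := he'
  have hc0 : 0 ≤ Real.cos ω := Real.cos_nonneg_of_mem_Icc ⟨by linarith [hω.1, Real.pi_pos], hω.2⟩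
  have hc1 : Real.cos ω ≤ 1 := Real.cos_le_one ω
  have key1 : ∀ e ∈ Icc (0 : ℝ) 1, ∀ ω' : ℝ,
      (q' : EReal) - equot (2 * q) (1 - Real.cos ω) ≤ deltaInt q' e' q e ω ω' := by
    rintro e ⟨h0, h1⟩ ω'
    have a1 := Real.cos_le_one ω'
    have a2 := Real.neg_one_le_cos ω'
    refine le_min ?_ ?_
    · exact EReal.sub_le_sub (aux_low q' e' _ hq' he0.le a1 (by nlinarith))
        (aux_up2 q e _ _ hq h0 h1 hc0 hc1 (by linarith))
    · unfold dminus rminus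
      rw [sub_eq_add_neg (1 : ℝ) (e' * _), sub_eq_add_neg (1 : ℝ) (e * _), ← mul_neg, ← mul_neg]
      exact EReal.sub_le_sub (aux_low q' e' _ hq' he0.le (by linarith) (by nlinarith))
        (aux_up2 q e _ _ hq h0 h1 hc0 hc1 le_rfl)
  have key2 : ∀ e ∈ Icc (0 : ℝ) 1, ∀ ω' : ℝ,
      ((q - Q' : ℝ) : EReal) ≤ deltaExt q' e' q e ω ω' := by
    rintro e ⟨h0, h1⟩ ω'
    have a1 := Real.cos_le_one ω'
    have a2 := Real.neg_one_le_cos ω'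
    have hn : ((q - Q' : ℝ) : EReal) = -((Q' : EReal) - (q : EReal)) := by
      rw [← EReal.coe_sub, ← EReal.coe_neg, neg_sub]
    rw [hn, hQ']
    refine le_min ?_ ?_
    · rw [EReal.neg_le_neg_iff]
      exact EReal.sub_le_sub (aux_up q' e' _ hq' he0.le he1 a2)
        (aux_low q e _ hq h0 hc1 (by nlinarith))
    · rw [EReal.neg_le_neg_iff]
      unfold dminus rminus
      rw [sub_eq_add_neg (1 : ℝ) (e' * _), sub_eq_add_neg (1 : ℝ) (e * _), ← mul_neg, ← mul_neg]
      exact EReal.sub_le_sub (aux_up q' e' _ hq' he0.le he1 (by linarith))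
        (aux_low q e _ hq h0 (by linarith) (by nlinarith))
  have eq1 : deltaInt q' e' q 1 ω π = (q' : EReal) - equot (2 * q) (1 - Real.cos ω) := by
    refine le_antisymm ((min_le_right _ _).trans (le_of_eq ?_)) (key1 1 ⟨zero_le_one, le_rfl⟩ π)
    unfold dminus rminus
    have b : equot (q' * (1 + e')) (1 - e' * Real.cos π) = (q' : EReal) := by
      have hp : 1 - e' * Real.cos π = 1 + e' := by rw [Real.cos_pi]; ring
      have hp2 : 1 + e' ≠ 0 := by linarith
      rw [hp, equot, if_neg hp2, mul_div_cancel_right₀ _ hp2]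
    rw [b, one_mul]
    congr 2
    ring
  have eq2 : deltaExt q' e' q 0 ω π = ((q - Q' : ℝ) : EReal) := by
    refine le_antisymm ((min_le_left _ _).trans (le_of_eq ?_)) (key2 0 ⟨le_rfl, zero_le_one⟩ π)
    unfold dplus rplus
    have hp : 1 + e' * Real.cos π = 1 - e' := by rw [Real.cos_pi]; ring
    have hp2 : 1 - e' ≠ 0 := by linarith
    rw [hp, equot, equot, if_neg hp2, if_neg (by simp), ← hQ', ← EReal.coe_sub, ← EReal.coe_neg]
    congr 1
    simp
  refine ⟨fun e he ω' _ => ?_, eq1, fun e he ω' _ => ?_, eq2⟩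
  · rw [eq1]; exact key1 e he ω'
  · rw [eq2]; exact key2 e he ω'
end
end

section
/- Fix q' > 0 and e' ∈ (0,1), and let Q' = q'(1+e')/(1−e'). If (q,ω) with q > 0 and ω ∈ [0,π/2] satisfies q' − 2q/(1−cos ω) ≤ 0 (interpreted as automatically true when ω = 0) and q − Q' ≤ 0, then there exists (e,ω') ∈ [0,1] × [0,π] such that d⁺(q,e,ω,ω') · d⁻(q,e,ω,ω') = 0, i.e. there is a crossing configuration. -/
open Real Set Filter Topology

noncomputable section

theorem equot_sub_eq_zero {a b c d : ℝ} (hb : b ≠ 0) (hd : d ≠ 0) (h : a * d = c * b) :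
    equot a b - equot c d = 0 := by
  have h2 : a / b = c / d := by rw [div_eq_div_iff hb hd, h]
  simp only [equot, if_neg hb, if_neg hd, h2]
  rw [← EReal.coe_sub, sub_self, EReal.coe_zero]

/-- If `ℓ^ω_int = q' - 2q/(1-cos ω) ≤ 0` (automatic when `ω = 0`) and `ℓ^ω_ext = q - Q' ≤ 0`,
then some `(e, ω') ∈ [0,1] × [0,π]` gives a crossing configuration, i.e. `d⁺ · d⁻ = 0`. -/
theorem exists_crossing_qom (q' e' : ℝ) (hq' : 0 < q') (he' : e' ∈ Ioo (0 : ℝ) 1)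
    (Q' : ℝ) (hQ' : Q' = q' * (1 + e') / (1 - e'))
    (q ω : ℝ) (hq : 0 < q) (hω : ω ∈ Icc 0 (π / 2))
    (hint : (q' : EReal) - equot (2 * q) (1 - Real.cos ω) ≤ 0)
    (hext : q - Q' ≤ 0) :
    ∃ e ∈ Icc (0 : ℝ) 1, ∃ ω' ∈ Icc (0 : ℝ) π,
      dplus q' e' q e ω ω' * dminus q' e' q e ω ω' = 0 := by
  obtain ⟨he0, he1⟩ := he'
  have hc0 : 0 ≤ Real.cos ω :=
    Real.cos_nonneg_of_mem_Icc ⟨by linarith [hω.1, Real.pi_pos], hω.2⟩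
  have hc1 : Real.cos ω ≤ 1 := Real.cos_le_one ω
  have hext2 : q * (1 - e') ≤ q' * (1 + e') := by
    rw [hQ', sub_nonpos, le_div_iff₀ (by linarith)] at hext
    exact hext
  have hint2 : q' * (1 - Real.cos ω) ≤ 2 * q := by
    by_cases h : 1 - Real.cos ω = 0
    · rw [h]; linarith
    · have hpos : 0 < 1 - Real.cos ω := lt_of_le_of_ne (by linarith) (Ne.symm h)
      rw [equot, if_neg h, ← EReal.coe_sub, ← EReal.coe_zero, EReal.coe_le_coe_iff,
        sub_nonpos, le_div_iff₀ hpos] at hint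
      exact hint
  rcases le_or_gt q' q with hqq | hqq
  · have hqe : 0 < q * e' := mul_pos hq he0
    refine ⟨0, ⟨le_refl _, zero_le_one⟩, Real.arccos ((q - q' * (1 + e')) / (q * e')),
      ⟨Real.arccos_nonneg _, Real.arccos_le_pi _⟩, ?_⟩
    have hx : Real.cos (Real.arccos ((q - q' * (1 + e')) / (q * e')))
        = (q - q' * (1 + e')) / (q * e') := by
      apply Real.cos_arccos
      · rw [le_div_iff₀ hqe]; nlinarith
      · rw [div_le_iff₀ hqe]; nlinarith
    have hk : 1 - e' * ((q - q' * (1 + e')) / (q * e')) = q' * (1 + e') / q := by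
      field_simp
      ring
    have : dminus q' e' q 0 ω (Real.arccos ((q - q' * (1 + e')) / (q * e'))) = 0 := by
      unfold dminus rminus
      rw [hx, hk]
      apply equot_sub_eq_zero
      · positivity
      · norm_num
      · field_simp
        ring
    rw [this, mul_zero]
  · have hD : 0 < q + q' * Real.cos ω := by positivity
    refine ⟨(q' - q) / (q + q' * Real.cos ω), ⟨div_nonneg (by linarith) hD.le, ?_⟩, π,
      ⟨Real.pi_pos.le, le_refl _⟩, ?_⟩
    · rw [div_le_one hD]; linarith
    have hk : 1 - (q' - q) / (q + q' * Real.cos ω) * Real.cos ω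
        = q * (1 + Real.cos ω) / (q + q' * Real.cos ω) := by
      field_simp
      ring
    have : dminus q' e' q ((q' - q) / (q + q' * Real.cos ω)) ω π = 0 := by
      unfold dminus rminus
      rw [hk, Real.cos_pi]
      apply equot_sub_eq_zero
      · linarith
      · positivity
      · field_simp
        ring
    rw [this, mul_zero]
end
end

section
/- Fix q' > 0 and e' ∈ (0,1), and let p' = q'(1+e'). For every q > 0 and ω ∈ [0,π/2], the maximum of δ_int(q,e,ω,ω') over (e,ω') ∈ [0,1] × [0,π] equals p' − q, and it is attained at (e,ω') = (0, π/2). -/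
open Real Set Filter Topology

noncomputable section

theorem equot_ge_aux (q a b : ℝ) (hb : 0 ≤ b) (h : q * b ≤ a) : (q : EReal) ≤ equot a b := by
  unfold equot
  split_ifs with h0
  · exact le_top
  · have hb' : 0 < b := lt_of_le_of_ne hb (Ne.symm h0)
    exact EReal.coe_le_coe_iff.2 ((le_div_iff₀ hb').2 h)

theorem equot_le_aux (p b : ℝ) (hp : 0 ≤ p) (hb : 1 ≤ b) : equot p b ≤ (p : EReal) := by
  unfold equot
  rw [if_neg (by linarith)]
  exact EReal.coe_le_coe_iff.2 (div_le_self hp hb)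

/-- The maximum of `δ_int` over `(e, ω') ∈ [0,1] × [0,π]` equals `p' - q`, attained at
`(e, ω') = (0, π/2)`. -/
theorem deltaInt_max_qom (q' e' : ℝ) (hq' : 0 < q') (he' : e' ∈ Ioo (0 : ℝ) 1)
    (p' : ℝ) (hp' : p' = q' * (1 + e'))
    (q ω : ℝ) (hq : 0 < q) (hω : ω ∈ Icc 0 (π / 2)) :
    IsGreatest ((fun pr : ℝ × ℝ => deltaInt q' e' q pr.1 ω pr.2) '' (Icc 0 1 ×ˢ Icc 0 π))
      (((p' - q : ℝ) : EReal)) ∧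
    deltaInt q' e' q 0 ω (π / 2) = ((p' - q : ℝ) : EReal) := by
  obtain ⟨he0, he1⟩ := he'
  have hval : deltaInt q' e' q 0 ω (π / 2) = ((p' - q : ℝ) : EReal) := by
    simp [deltaInt, dplus, dminus, rplus, rminus, equot, hp']
  refine ⟨⟨⟨(0, π / 2), ?_, hval⟩, ?_⟩, hval⟩
  · have := Real.pi_pos
    simp only [mem_prod, mem_Icc]
    refine ⟨⟨le_refl _, zero_le_one⟩, ?_, ?_⟩ <;> linarith
  · rintro _ ⟨⟨e, w⟩, ⟨⟨h0, h1⟩, -⟩, rfl⟩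
    simp only at h0 h1 ⊢
    have hc0 := Real.neg_one_le_cos ω
    have hc1 := Real.cos_le_one ω
    have hp0 : 0 ≤ q' * (1 + e') := by positivity
    have k1 : e * Real.cos ω ≤ e := by nlinarith
    have k2 : -e ≤ e * Real.cos ω := by nlinarith
    rw [EReal.coe_sub, hp']
    rcases le_total 0 (Real.cos w) with hw | hw
    · refine (min_le_left _ _).trans (EReal.sub_le_sub (equot_le_aux _ _ hp0 ?_)
        (equot_ge_aux _ _ _ ?_ ?_))
      · nlinarith
      · linarith
      · exact mul_le_mul_of_nonneg_left (by linarith) hq.le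
    · refine (min_le_right _ _).trans (EReal.sub_le_sub (equot_le_aux _ _ hp0 ?_)
        (equot_ge_aux _ _ _ ?_ ?_))
      · nlinarith
      · linarith
      · exact mul_le_mul_of_nonneg_left (by linarith) hq.le
end
end

section
/- Fix q' > 0 and e' ∈ (0,1), and let p' = q'(1+e'). For every q > 0 and ω ∈ [0,π/2], the maximum of δ_ext(q,e,ω,ω') over (e,ω') ∈ [0,1] × [0,π] equals u^ω_ext(q,ω) = min{2q/(1−cos ω) − p'/(1−ξ̂'₊), 2q/(1+cos ω) − q'} (the first term interpreted as +∞ when ω = 0), where ξ̂'₊ = min{ξ'₊, e'} and ξ'₊ = 4q·cos ω / (p'·sin²ω + √(p'²·sin⁴ω + 16 q²·cos²ω)). -/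
open Real Set Filter Topology

noncomputable section

theorem aux_min (a b : ℝ) : ((min a b : ℝ) : EReal) = min (a : EReal) (b : EReal) :=
  EReal.coe_strictMono.monotone.map_min

theorem aux_dp (q' e' q e ω ω' : ℝ) (h1 : 0 < 1 + e * Real.cos ω) (h2 : 0 < 1 + e' * Real.cos ω') :
    -dplus q' e' q e ω ω' = ((q * (1 + e) / (1 + e * Real.cos ω)
      - q' * (1 + e') / (1 + e' * Real.cos ω') : ℝ) : EReal) := by
  unfold dplus rplus equot
  rw [if_neg h1.ne', if_neg h2.ne', ← EReal.coe_sub, ← EReal.coe_neg, neg_sub]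

theorem aux_dm (q' e' q e ω ω' : ℝ) (h1 : 0 < 1 - e * Real.cos ω) (h2 : 0 < 1 - e' * Real.cos ω') :
    -dminus q' e' q e ω ω' = ((q * (1 + e) / (1 - e * Real.cos ω)
      - q' * (1 + e') / (1 - e' * Real.cos ω') : ℝ) : EReal) := by
  unfold dminus rminus equot
  rw [if_neg h1.ne', if_neg h2.ne', ← EReal.coe_sub, ← EReal.coe_neg, neg_sub]

theorem aux_mono (q e c : ℝ) (hq : 0 < q) (he0 : 0 ≤ e) (he1 : e ≤ 1) (hc : c ≤ 1)
    (h1 : 0 < 1 + e * c) (h2 : 0 < 1 + c) :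
    q * (1 + e) / (1 + e * c) ≤ 2 * q / (1 + c) := by
  rw [div_le_div_iff₀ h1 h2]
  nlinarith [mul_nonneg hq.le (mul_nonneg (sub_nonneg.2 he1) (sub_nonneg.2 hc))]

theorem aux_A (p a b : ℝ) (hp : 0 < p) (h : a ≤ b) (ha : 0 < 1 + a) :
    p / (1 + b) ≤ p / (1 + a) := by
  apply div_le_div_of_nonneg_left hp.le ha; linarith

theorem aux_xi (p q ω : ℝ) (hp : 0 < p) (hq : 0 < q) (hc0 : 0 ≤ Real.cos ω) :
    0 ≤ xiStar p q ω ∧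
    p * (1 - Real.cos ω ^ 2) * xiStar p q ω = 2 * q * Real.cos ω * (1 - xiStar p q ω ^ 2) := by
  unfold xiStar
  have hs : Real.sin ω ^ 4 = (Real.sin ω ^ 2) ^ 2 := by ring
  rw [hs, Real.sin_sq]
  have hc1 := Real.cos_sq_le_one ω
  generalize Real.cos ω = c at *
  have hR0 := Real.sqrt_nonneg (p ^ 2 * (1 - c ^ 2) ^ 2 + 16 * q ^ 2 * c ^ 2)
  have hR := Real.sq_sqrt (show 0 ≤ p ^ 2 * (1 - c ^ 2) ^ 2 + 16 * q ^ 2 * c ^ 2 by positivity)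
  have hRp : 0 < √(p ^ 2 * (1 - c ^ 2) ^ 2 + 16 * q ^ 2 * c ^ 2) := by
    apply Real.sqrt_pos.2
    rcases hc0.eq_or_lt with h | h
    · rw [← h]; norm_num; positivity
    · positivity
  generalize √(p ^ 2 * (1 - c ^ 2) ^ 2 + 16 * q ^ 2 * c ^ 2) = R at *
  have hs0 : 0 ≤ p * (1 - c ^ 2) := mul_nonneg hp.le (by linarith)
  have hD : 0 < p * (1 - c ^ 2) + R := by linarith
  refine ⟨by positivity, ?_⟩
  have hR' : R ^ 2 = (p * (1 - c ^ 2)) ^ 2 + 16 * q ^ 2 * c ^ 2 := by rw [hR]; ring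
  generalize p * (1 - c ^ 2) = s at *
  field_simp
  linear_combination (-2 * c) * hR'

theorem aux_AB (p q c h X : ℝ) (hp : 0 < p) (hq : 0 < q) (hc0 : 0 ≤ c) (hc1 : c < 1)
    (hX : p * (1 - c ^ 2) * X = 2 * q * c * (1 - X ^ 2)) (h0 : 0 ≤ h) (hX1 : h ≤ X) (h1 : h < 1) :
    2 * q / (1 + c) - p / (1 + h) ≤ 2 * q / (1 - c) - p / (1 - h) := by
  have key : p * (1 - c ^ 2) * h ≤ 2 * q * c * (1 - h ^ 2) := by
    have a1 : 0 ≤ p * (1 - c ^ 2) := mul_nonneg hp.le (by nlinarith)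
    have a2 : 0 ≤ 2 * q * c := by positivity
    have := mul_le_mul_of_nonneg_left hX1 a1
    have := mul_le_mul_of_nonneg_left (pow_le_pow_left₀ h0 hX1 2) a2
    linarith
  have e1 : 0 < 1 - c := by linarith
  have e2 : 0 < 1 - h := by linarith
  have e3 : 0 < 1 + c := by linarith
  have e4 : 0 < 1 + h := by linarith
  have : 2 * q / (1 - c) - p / (1 - h) - (2 * q / (1 + c) - p / (1 + h)) =
      2 * (2 * q * c * (1 - h ^ 2) - p * (1 - c ^ 2) * h) / ((1 - c) * (1 + c) * (1 - h) * (1 + h)) := by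
    field_simp; ring
  have h3 : 0 ≤ 2 * (2 * q * c * (1 - h ^ 2) - p * (1 - c ^ 2) * h) / ((1 - c) * (1 + c) * (1 - h) * (1 + h)) := by
    apply div_nonneg
    · linarith
    · positivity
  linarith

theorem aux_BA (p q c h : ℝ) (hc0 : 0 ≤ c) (hc1 : c < 1)
    (hX : p * (1 - c ^ 2) * h = 2 * q * c * (1 - h ^ 2)) (h0 : 0 ≤ h) (h1 : h < 1) :
    2 * q / (1 - c) - p / (1 - h) = 2 * q / (1 + c) - p / (1 + h) := by
  have e1 : 1 - c ≠ 0 := by linarith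
  have e2 : 1 - h ≠ 0 := by linarith
  have e3 : 1 + c ≠ 0 := by linarith
  have e4 : 1 + h ≠ 0 := by linarith
  have : 2 * q / (1 - c) - p / (1 - h) - (2 * q / (1 + c) - p / (1 + h)) =
      2 * (2 * q * c * (1 - h ^ 2) - p * (1 - c ^ 2) * h) / ((1 - c) * (1 + c) * (1 - h) * (1 + h)) := by
    field_simp; ring
  rw [hX, sub_self, mul_zero, zero_div] at this
  linarith

/-- The maximum of `δ_ext` over `(e, ω') ∈ [0,1] × [0,π]` equals
`u^ω_ext = min{2q/(1-cos ω) - p'/(1-ξ̂'₊), 2q/(1+cos ω) - q'}` (first term `+∞` when `ω = 0`). -/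
theorem deltaExt_max_qom (q' e' : ℝ) (hq' : 0 < q') (he' : e' ∈ Ioo (0 : ℝ) 1)
    (p' : ℝ) (hp' : p' = q' * (1 + e'))
    (q ω : ℝ) (hq : 0 < q) (hω : ω ∈ Icc 0 (π / 2)) :
    IsGreatest ((fun pr : ℝ × ℝ => deltaExt q' e' q pr.1 ω pr.2) '' (Icc 0 1 ×ˢ Icc 0 π))
      (uExtOm q' e' p' q ω) := by
  obtain ⟨he0, he1⟩ := he'
  have hp : 0 < p' := by rw [hp']; positivity
  have hc0 : 0 ≤ Real.cos ω := Real.cos_nonneg_of_mem_Icc ⟨by linarith [hω.1, Real.pi_pos], hω.2⟩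
  have hc1 := Real.cos_le_one ω
  obtain ⟨hX0, hX⟩ := aux_xi p' q ω hp hq hc0
  have hqp : q' = p' / (1 + e') := by rw [hp']; field_simp
  have hxb : ∀ ω' : ℝ, -e' ≤ e' * Real.cos ω' ∧ e' * Real.cos ω' ≤ e' := fun ω' =>
    ⟨by nlinarith [Real.neg_one_le_cos ω'], by nlinarith [Real.cos_le_one ω']⟩
  have hA : ∀ e ∈ Icc (0 : ℝ) 1, ∀ ω', -dplus q' e' q e ω ω' ≤
      ((2 * q / (1 + Real.cos ω) - p' / (1 + e' * Real.cos ω') : ℝ) : EReal) := by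
    intro e he ω'
    have h1 : 0 < 1 + e * Real.cos ω := by have := mul_nonneg he.1 hc0; linarith
    rw [aux_dp _ _ _ _ _ _ h1 (by linarith [(hxb ω').1]), EReal.coe_le_coe_iff, hp']
    have := aux_mono q e (Real.cos ω) hq he.1 he.2 hc1 h1 (by linarith)
    linarith
  have hAe : ∀ ω', 2 * q / (1 + Real.cos ω) - p' / (1 + e' * Real.cos ω') ≤
      2 * q / (1 + Real.cos ω) - q' := by
    intro ω'
    rw [hqp]
    have := aux_A p' _ _ hp (hxb ω').2 (by linarith [(hxb ω').1])
    linarith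
  rcases hc1.eq_or_lt with hc | hc
  · have hU : uExtOm q' e' p' q ω = ((2 * q / (1 + Real.cos ω) - q' : ℝ) : EReal) := by
      unfold uExtOm equot
      rw [if_pos (by rw [hc]; norm_num), EReal.top_sub_coe, min_eq_right le_top]
    rw [hU]
    constructor
    · refine ⟨(1, 0), ⟨⟨by norm_num, by norm_num⟩, ⟨le_rfl, Real.pi_pos.le⟩⟩, ?_⟩
      show deltaExt q' e' q 1 ω 0 = _
      have hm : -dminus q' e' q 1 ω 0 = ⊤ := by
        unfold dminus rminus equot
        rw [if_pos (by rw [hc]; norm_num : 1 - 1 * Real.cos ω = 0),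
          if_neg (by rw [Real.cos_zero]; linarith), EReal.sub_top, EReal.neg_bot]
      unfold deltaExt
      rw [hm, min_eq_left le_top, aux_dp _ _ _ _ _ _ (by linarith) (by rw [Real.cos_zero]; linarith),
        Real.cos_zero, hqp]
      congr 1
      rw [← hqp, ← hp', mul_one, one_mul, ← hqp]; ring
    · rintro _ ⟨⟨e, ω'⟩, ⟨he, hω'⟩, rfl⟩
      exact (min_le_left _ _).trans ((hA e he ω').trans (EReal.coe_le_coe_iff.2 (hAe ω')))
  · set h := min (xiStar p' q ω) e' with hh
    have hhX : h ≤ xiStar p' q ω := min_le_left _ _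
    have hhe : h ≤ e' := min_le_right _ _
    have hh0 : 0 ≤ h := le_min hX0 he0.le
    have hAB := aux_AB p' q _ h _ hp hq hc0 hc hX hh0 hhX (by linarith)
    have hU : uExtOm q' e' p' q ω = ((min (2 * q / (1 - Real.cos ω) - p' / (1 - h))
        (2 * q / (1 + Real.cos ω) - q') : ℝ) : EReal) := by
      unfold uExtOm equot
      rw [if_neg (by linarith), ← EReal.coe_sub, ← hh, aux_min]
    rw [hU]
    constructor
    · refine ⟨(1, Real.arccos (h / e')), ⟨⟨by norm_num, by norm_num⟩,
        ⟨Real.arccos_nonneg _, Real.arccos_le_pi _⟩⟩, ?_⟩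
      show deltaExt q' e' q 1 ω (Real.arccos (h / e')) = _
      have hcos : e' * Real.cos (Real.arccos (h / e')) = h := by
        rw [Real.cos_arccos (by linarith [div_nonneg hh0 he0.le]) ((div_le_one he0).2 hhe)]
        field_simp
      unfold deltaExt
      rw [aux_dp _ _ _ _ _ _ (by linarith) (by rw [hcos]; linarith),
        aux_dm _ _ _ _ _ _ (by linarith) (by rw [hcos]; linarith), hcos, ← hp', ← aux_min]
      congr 1
      have e2 : q * (1 + 1) = 2 * q := by ring
      rw [one_mul, e2, min_eq_left hAB]
      rcases le_total (xiStar p' q ω) e' with hl | hl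
      · have hx : h = xiStar p' q ω := min_eq_left hl
        rw [← hx] at hX
        rw [aux_BA p' q _ h hc0 hc hX hh0 (by linarith), min_eq_left]
        have := hAe (Real.arccos (h / e'))
        rwa [hcos] at this
      · have hx : h = e' := min_eq_right hl
        rw [hx] at hAB ⊢
        rw [← hqp] at hAB ⊢
        rw [min_eq_right hAB]
    · rintro _ ⟨⟨e, ω'⟩, ⟨he, hω'⟩, rfl⟩
      show deltaExt q' e' q e ω ω' ≤ _
      have hd := (min_le_left _ _).trans (hA e he ω') (a := deltaExt q' e' q e ω ω')
      rw [aux_min]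
      refine le_min ?_ (hd.trans (EReal.coe_le_coe_iff.2 (hAe ω')))
      have hx := hxb ω'
      rcases le_total h (e' * Real.cos ω') with hl | hl
      · refine (min_le_right _ _).trans ?_
        have h1 : 0 < 1 - e * Real.cos ω := by nlinarith [he.1, he.2]
        rw [aux_dm _ _ _ _ _ _ h1 (by linarith), EReal.coe_le_coe_iff, ← hp']
        have m1 := aux_mono q e (-Real.cos ω) hq he.1 he.2 (by linarith) (by linarith) (by linarith)
        have m2 := aux_A p' (-(e' * Real.cos ω')) (-h) hp (by linarith) (by linarith)
        simp only [mul_neg, ← sub_eq_add_neg] at m1 m2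
        linarith
      · refine hd.trans (EReal.coe_le_coe_iff.2 ?_)
        have m2 := aux_A p' _ _ hp hl (by linarith)
        linarith
end
end

section
/- Fix q' > 0 and e' ∈ (0,1), and let p' = q'(1+e'), Q' = q'(1+e')/(1−e'). For every q > 0 and ω ∈ [0,π/2], the maximum of δ_link(q,e,ω,ω') over (e,ω') ∈ [0,1] × [0,π] equals u^ω_link(q,ω) = min{Q' − q(1+ê₊)/(1+ê₊·cos ω), 2q/(1−cos ω) − q'} (the second term interpreted as +∞ when ω = 0), where ê₊ = max{0, min{e₊, 1}} and e₊ = 2(p' − q(1−e'²)) / (q(1−e'²) + √(q²(1−e'²)² + 4 p'·cos²ω·(p' − q(1−e'²)))); moreover this maximum is attained by δ_link^(ii) = min{d⁺, −d⁻} at ω' = π. -/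
open Real Set Filter Topology

noncomputable section

lemma aux_equot_pos (a b : ℝ) (hb : 0 < b) : equot a b = ((a / b : ℝ) : EReal) := by
  simp [equot, hb.ne']

lemma aux_B_mono (q c e f : ℝ) (hq : 0 < q) (hc0 : 0 ≤ c) (hc1 : c ≤ 1) (he : 0 ≤ e)
    (hef : e ≤ f) (hf : f ≤ 1) :
    equot (q * (1 + e)) (1 - e * c) ≤ equot (q * (1 + f)) (1 - f * c) := by
  by_cases h : 1 - f * c = 0
  · simp [equot, h]
  · have h1 : 0 < 1 - f * c := lt_of_le_of_ne (by nlinarith) (Ne.symm h)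
    have h2 : 0 < 1 - e * c := by nlinarith
    rw [aux_equot_pos _ _ h1, aux_equot_pos _ _ h2, EReal.coe_le_coe_iff]
    apply div_le_div₀ <;> nlinarith

lemma aux_A_mono (q c e f : ℝ) (hq : 0 < q) (hc0 : 0 ≤ c) (hc1 : c ≤ 1) (he : 0 ≤ e)
    (hef : e ≤ f) :
    q * (1 + e) / (1 + e * c) ≤ q * (1 + f) / (1 + f * c) := by
  have h1 : 0 < 1 + e * c := by positivity
  have h2 : 0 < 1 + f * c := by have := he.trans hef; positivity
  rw [div_le_div_iff₀ h1 h2]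
  have : 0 ≤ q * ((f - e) * (1 - c)) :=
    mul_nonneg hq.le (mul_nonneg (by linarith) (by linarith))
  nlinarith

lemma aux_A_le_B (q c e : ℝ) (hq : 0 < q) (hc0 : 0 ≤ c) (hc1 : c ≤ 1) (he : 0 ≤ e)
    (he1 : e ≤ 1) :
    ((q * (1 + e) / (1 + e * c) : ℝ) : EReal) ≤ equot (q * (1 + e)) (1 - e * c) := by
  by_cases h : 1 - e * c = 0
  · simp [equot, h]
  · have h1 : 0 < 1 - e * c := lt_of_le_of_ne (by nlinarith) (Ne.symm h)
    rw [aux_equot_pos _ _ h1, EReal.coe_le_coe_iff]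
    have := mul_nonneg he hc0
    exact div_le_div_of_nonneg_left (by positivity) h1 (by linarith)

/-- Comparison of the two link functions with the value at `π`. -/
lemma aux_cmp (P M A a Q : ℝ) (B : EReal) (hAB : (A : EReal) ≤ B) (hP : P ≤ Q) (hP' : a ≤ P)
    (hM : M ≤ Q) (hM' : a ≤ M) :
    max (min (-((P : EReal) - A)) ((M : EReal) - B)) (min ((P : EReal) - A) (-((M : EReal) - B)))
      ≤ min ((Q : EReal) - A) (-((a : EReal) - B)) := by
  induction B using EReal.rec with
  | bot => simp at hAB
  | top =>
    have h1 : ∀ x : ℝ, (x : EReal) - ⊤ = ⊥ := fun x => EReal.sub_top _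
    rw [h1, h1, EReal.neg_bot, min_eq_right bot_le, min_eq_left le_top, min_eq_left le_top,
      max_eq_right bot_le, ← EReal.coe_sub, ← EReal.coe_sub, EReal.coe_le_coe_iff]
    linarith
  | coe B =>
    have h : A ≤ B := by exact_mod_cast hAB
    norm_cast
    refine max_le (le_min ?_ ?_) (le_min ?_ ?_)
    · exact (min_le_right _ _).trans (by rw [EReal.coe_le_coe_iff]; linarith)
    · exact (min_le_left _ _).trans (by rw [EReal.coe_le_coe_iff]; linarith)
    · exact (min_le_left _ _).trans (by rw [EReal.coe_le_coe_iff]; linarith)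
    · exact (min_le_right _ _).trans (by rw [EReal.coe_le_coe_iff]; linarith)

lemma aux_hat (p' e' q ω : ℝ) (hp : 0 < p') (hk : 0 < q * (1 - e' ^ 2)) :
    (0 < eHat p' e' q ω → p' * cos ω ^ 2 * eHat p' e' q ω ^ 2 + q * (1 - e' ^ 2) * eHat p' e' q ω
      + q * (1 - e' ^ 2) - p' ≤ 0) ∧
    (eHat p' e' q ω < 1 → 0 ≤ p' * cos ω ^ 2 * eHat p' e' q ω ^ 2
      + q * (1 - e' ^ 2) * eHat p' e' q ω + q * (1 - e' ^ 2) - p') := by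
  have hD : q ^ 2 * (1 - e' ^ 2) ^ 2 = (q * (1 - e' ^ 2)) ^ 2 := by ring
  unfold eHat eStar
  rw [hD]
  generalize q * (1 - e' ^ 2) = k at *
  generalize cos ω = c at *
  by_cases h : p' ≤ k
  · have h0 : 2 * (p' - k) / (k + √(k ^ 2 + 4 * p' * c ^ 2 * (p' - k))) ≤ 0 :=
      div_nonpos_of_nonpos_of_nonneg (by linarith) (by positivity)
    rw [max_eq_left ((min_le_left _ _).trans h0)]
    exact ⟨fun h => absurd h (lt_irrefl _), fun _ => by nlinarith⟩
  · push Not at h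
    have hpk : 0 < p' - k := by linarith
    have hs : √(k ^ 2 + 4 * p' * c ^ 2 * (p' - k)) ^ 2 = k ^ 2 + 4 * p' * c ^ 2 * (p' - k) :=
      Real.sq_sqrt (by positivity)
    have hs0 := Real.sqrt_nonneg (k ^ 2 + 4 * p' * c ^ 2 * (p' - k))
    generalize √(k ^ 2 + 4 * p' * c ^ 2 * (p' - k)) = s at *
    have hks : 0 < k + s := by linarith
    obtain ⟨E, hE⟩ : ∃ E, E = 2 * (p' - k) / (k + s) := ⟨_, rfl⟩
    have hE0 : 0 < E := by rw [hE]; positivity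
    have hroot : p' * c ^ 2 * E ^ 2 + k * E + k - p' = 0 := by
      rw [hE]; field_simp
      linear_combination (-(p' - k)) * hs
    rw [← hE]
    have hc2 : 0 ≤ p' * c ^ 2 := by positivity
    rcases le_total E 1 with h1 | h1
    · rw [min_eq_left h1, max_eq_right hE0.le]
      exact ⟨fun _ => hroot.le, fun _ => hroot.ge⟩
    · rw [min_eq_right h1, max_eq_right zero_le_one]
      refine ⟨fun _ => ?_, fun h => absurd h (lt_irrefl _)⟩
      nlinarith [mul_nonneg hc2 (by nlinarith : 0 ≤ E ^ 2 - 1), mul_nonneg hk.le (by linarith : 0 ≤ E - 1)]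

/-- The maximum of `δ_link` over `(e, ω') ∈ [0,1] × [0,π]` equals
`u^ω_link = min{Q' - q(1+ê₊)/(1+ê₊ cos ω), 2q/(1-cos ω) - q'}` (second term `+∞` when `ω = 0`),
and it is attained by `δ_link^(ii) = min{d⁺, -d⁻}` at `ω' = π`. -/
theorem deltaLink_max_qom (q' e' : ℝ) (hq' : 0 < q') (he' : e' ∈ Ioo (0 : ℝ) 1)
    (p' Q' : ℝ) (hp' : p' = q' * (1 + e')) (hQ' : Q' = q' * (1 + e') / (1 - e'))
    (q ω : ℝ) (hq : 0 < q) (hω : ω ∈ Icc 0 (π / 2)) :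
    IsGreatest ((fun pr : ℝ × ℝ => deltaLink q' e' q pr.1 ω pr.2) '' (Icc 0 1 ×ˢ Icc 0 π))
      (uLinkOm q' e' p' Q' q ω) ∧
    ∃ e ∈ Icc (0 : ℝ) 1,
      min (dplus q' e' q e ω π) (-dminus q' e' q e ω π) = uLinkOm q' e' p' Q' q ω := by
  obtain ⟨he0, he1⟩ := he'
  have hc0 : 0 ≤ cos ω := Real.cos_nonneg_of_mem_Icc ⟨by linarith [hω.1, Real.pi_pos], hω.2⟩
  have hc1 : cos ω ≤ 1 := Real.cos_le_one ω
  have hp : 0 < p' := by rw [hp']; positivity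
  have he2 : 0 < 1 - e' ^ 2 := by nlinarith
  have hk : 0 < q * (1 - e' ^ 2) := by positivity
  obtain ⟨hlo, hhi⟩ := aux_hat p' e' q ω hp hk
  have hh0 : 0 ≤ eHat p' e' q ω := le_max_left _ _
  have hh1 : eHat p' e' q ω ≤ 1 := max_le zero_le_one (min_le_right _ _)
  unfold uLinkOm
  generalize eHat p' e' q ω = E at *
  have hQ0 : q' ≤ Q' := by
    rw [hQ', le_div_iff₀ (by linarith)]; nlinarith
  -- bounds for the planet's nodal distances
  have hpl : ∀ x, -e' ≤ x → x ≤ e' → equot (q' * (1 + e')) (1 + x) =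
      ((q' * (1 + e') / (1 + x) : ℝ) : EReal) ∧ q' ≤ q' * (1 + e') / (1 + x) ∧
      q' * (1 + e') / (1 + x) ≤ Q' := by
    intro x hx1 hx2
    have hx : 0 < 1 + x := by linarith
    refine ⟨aux_equot_pos _ _ hx, ?_, ?_⟩
    · rw [le_div_iff₀ hx]; nlinarith
    · rw [hQ']; exact div_le_div_of_nonneg_left (by positivity) (by linarith) (by linarith)
  have hrp : ∀ e, 0 ≤ e → rplus q e ω = ((q * (1 + e) / (1 + e * cos ω) : ℝ) : EReal) :=
    fun e he => aux_equot_pos _ _ (by positivity)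
  have hdp : ∀ e, 0 ≤ e → dplus q' e' q e ω π =
      (Q' : EReal) - ((q * (1 + e) / (1 + e * cos ω) : ℝ) : EReal) := by
    intro e he
    have h1 : 1 + e' * cos π = 1 - e' := by rw [Real.cos_pi]; ring
    rw [dplus, hrp e he, h1, aux_equot_pos _ _ (by linarith), ← hQ']
  have hdm : ∀ e, dminus q' e' q e ω π = (q' : EReal) - rminus q e ω := by
    intro e
    have h1 : 1 - e' * cos π = 1 + e' := by rw [Real.cos_pi]; ring
    rw [dminus, h1, aux_equot_pos _ _ (by linarith), mul_div_cancel_right₀ _ (by linarith)]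
  have hneg : ∀ B : EReal, -((q' : EReal) - B) = B - q' := by
    intro B
    rw [EReal.neg_sub (by simp) (by simp), add_comm, sub_eq_add_neg]
  have hone : equot (2 * q) (1 - cos ω) = rminus q 1 ω := by
    rw [rminus]; congr 1 <;> ring
  have hBm : ∀ e f, 0 ≤ e → e ≤ f → f ≤ 1 → rminus q e ω - (q' : EReal) ≤ rminus q f ω - (q' : EReal) :=
    fun e f h1 h2 h3 => EReal.sub_le_sub (aux_B_mono q _ e f hq hc0 hc1 h1 h2 h3) le_rfl
  -- relation between the sum of nodal distances and the quadratic
  have hsum : Q' + q' = 2 * p' / (1 - e' ^ 2) := by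
    rw [hQ', hp']
    have : (1 - e') ≠ 0 := by linarith
    have h3 : 1 - e' ^ 2 = (1 - e') * (1 + e') := by ring
    have h4 : (1 + e') ≠ 0 := by linarith
    rw [h3]; field_simp; ring
  have hAB : 0 < 1 - E * cos ω → q * (1 + E) / (1 - E * cos ω) + q * (1 + E) / (1 + E * cos ω)
      = 2 * (q * (1 + E)) / (1 - E ^ 2 * cos ω ^ 2) := by
    intro h
    have h1 : 1 + E * cos ω ≠ 0 := by positivity
    have h2 : 1 - E ^ 2 * cos ω ^ 2 = (1 - E * cos ω) * (1 + E * cos ω) := by ring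
    have h3 := h.ne'
    rw [h2]; field_simp; ring
  have hAp : 0 < 1 + E * cos ω := by positivity
  -- for positive E
  have hlo' : 0 < E → rminus q E ω - (q' : EReal) ≤
      ((Q' - q * (1 + E) / (1 + E * cos ω) : ℝ) : EReal) := by
    intro h
    have h1 := hlo h
    have h2 : 0 < 1 - E ^ 2 * cos ω ^ 2 := by
      by_contra hcon
      push Not at hcon
      nlinarith [mul_nonneg hp.le (by linarith : 0 ≤ E ^ 2 * cos ω ^ 2 - 1), mul_pos hk h]
    have h3 : 0 < 1 - E * cos ω := by
      by_contra hcon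
      push Not at hcon
      nlinarith
    have h4 := hAB h3
    have h5 : 2 * (q * (1 + E)) / (1 - E ^ 2 * cos ω ^ 2) ≤ Q' + q' := by
      rw [hsum, div_le_div_iff₀ h2 he2]; nlinarith
    rw [rminus, aux_equot_pos _ _ h3]
    norm_cast
    linarith
  have hhi' : E < 1 → ((Q' - q * (1 + E) / (1 + E * cos ω) : ℝ) : EReal) ≤
      rminus q E ω - (q' : EReal) := by
    intro h
    have h1 := hhi h
    have h3 : 0 < 1 - E * cos ω := by nlinarith
    have h2 : 0 < 1 - E ^ 2 * cos ω ^ 2 := by nlinarith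
    have h4 := hAB h3
    have h5 : Q' + q' ≤ 2 * (q * (1 + E)) / (1 - E ^ 2 * cos ω ^ 2) := by
      rw [hsum, div_le_div_iff₀ he2 h2]; nlinarith
    rw [rminus, aux_equot_pos _ _ h3]
    norm_cast
    linarith
  have hatt : min (dplus q' e' q E ω π) (-dminus q' e' q E ω π) =
      min (((Q' - q * (1 + E) / (1 + E * cos ω) : ℝ) : EReal))
        (equot (2 * q) (1 - cos ω) - (q' : EReal)) := by
    rw [hdp E hh0, hdm, hneg, hone, ← EReal.coe_sub]
    rcases hh1.lt_or_eq with h | h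
    · rw [min_eq_left (hhi' h), min_eq_left ((hhi' h).trans (hBm E 1 hh0 hh1 le_rfl))]
    · rw [h]
  have hub : ∀ e ω', 0 ≤ e → e ≤ 1 → deltaLink q' e' q e ω ω' ≤
      min (((Q' - q * (1 + E) / (1 + E * cos ω) : ℝ) : EReal))
        (equot (2 * q) (1 - cos ω) - (q' : EReal)) := by
    intro e ω' h0 h1
    have hx1 : -e' ≤ e' * cos ω' := by nlinarith [Real.neg_one_le_cos ω']
    have hx2 : e' * cos ω' ≤ e' := by nlinarith [Real.cos_le_one ω']
    obtain ⟨a1, a2, a3⟩ := hpl _ hx1 hx2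
    obtain ⟨b1, b2, b3⟩ := hpl (-(e' * cos ω')) (by linarith) (by linarith)
    rw [← sub_eq_add_neg] at b1 b2 b3
    have key : deltaLink q' e' q e ω ω' ≤
        min ((Q' : EReal) - ((q * (1 + e) / (1 + e * cos ω) : ℝ) : EReal))
          (-((q' : EReal) - rminus q e ω)) := by
      rw [deltaLink, dplus, dminus, a1, b1, hrp e h0]
      exact aux_cmp _ _ _ _ _ _ (aux_A_le_B q _ e hq hc0 hc1 h0 h1) a3 a2 b3 b2
    refine key.trans ?_
    rw [hneg, hone, ← EReal.coe_sub]
    refine le_min ?_ ((min_le_right _ _).trans (hBm e 1 h0 h1 le_rfl))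
    rcases le_or_gt E e with h | h
    · refine (min_le_left _ _).trans ?_
      have := aux_A_mono q _ E e hq hc0 hc1 hh0 h
      rw [EReal.coe_le_coe_iff]; linarith
    · exact (min_le_right _ _).trans ((hBm e E h0 h.le hh1).trans (hlo' (h0.trans_lt h)))
  refine ⟨⟨⟨(E, π), ⟨⟨hh0, hh1⟩, Real.pi_pos.le, le_rfl⟩, ?_⟩, ?_⟩, E, ⟨hh0, hh1⟩, hatt⟩
  · refine le_antisymm (hub E π hh0 hh1) ?_
    rw [← hatt]
    exact le_max_right _ _
  · rintro _ ⟨⟨e, ω'⟩, ⟨⟨h0, h1⟩, -⟩, rfl⟩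
    exact hub e ω' h0 h1
end
end

section
/- Fix q' > 0 and e' ∈ (0,1), and let p' = q'(1+e'), Q' = q'(1+e')/(1−e'). For (q,ω) with q > 0 and ω ∈ [0,π/2], one has u^ω_link(q,ω) = 0 if and only if q' − 2q/(1−cos ω) = 0 or q − Q' = 0; more precisely, if q = Q' then u^ω_link(q,ω) = Q' − q = 0, and if 2q/(1−cos ω) = q' then u^ω_link(q,ω) = 2q/(1−cos ω) − q' = 0. Here u^ω_link(q,ω) = min{Q' − q(1+ê₊)/(1+ê₊·cos ω), 2q/(1−cos ω) − q'} with ê₊ = max{0, min{e₊, 1}} and e₊ = 2(p' − q(1−e'²)) / (q(1−e'²) + √(q²(1−e'²)² + 4 p'·cos²ω·(p' − q(1−e'²)))). -/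
open Real Set Filter Topology

noncomputable section

theorem aux_poly (a b D s e : ℝ) (hD : 0 < D) (hs : 0 ≤ s) (he : 0 < e)
    (hss : s ^ 2 = b ^ 2 + 4 * a * D) (h : e * (b + s) ≤ 2 * D) : a * e ^ 2 + b * e ≤ D := by
  have h1 : e * s ≤ 2 * D - b * e := by linarith
  have h0 : 0 ≤ e * s := by positivity
  have h2 : (e * s) ^ 2 ≤ (2 * D - b * e) ^ 2 := pow_le_pow_left₀ h0 h1 2
  rw [mul_pow, hss] at h2
  by_contra hc
  push Not at hc
  have := mul_pos hD (sub_pos.2 hc)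
  nlinarith

theorem aux_pos (q' e' p' Q' q ω : ℝ) (hq' : 0 < q') (he0 : 0 < e') (he1 : e' < 1)
    (hp' : p' = q' * (1 + e')) (hQ' : Q' = q' * (1 + e') / (1 - e')) (hq : 0 < q)
    (hc0 : 0 ≤ Real.cos ω) (hpos : 0 < eHat p' e' q ω) :
    0 < Q' - q * (1 + eHat p' e' q ω) / (1 + eHat p' e' q ω * Real.cos ω) := by
  have hle : eHat p' e' q ω ≤ eStar p' e' q ω := by
    unfold eHat at hpos ⊢
    have h : 0 < min (eStar p' e' q ω) 1 := by
      rcases lt_max_iff.1 hpos with h | h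
      · exact absurd h (lt_irrefl _)
      · exact h
    rw [max_eq_right h.le]
    exact min_le_left _ _
  set e := eHat p' e' q ω
  set c := Real.cos ω
  have hb : 0 < q * (1 - e' ^ 2) := mul_pos hq (by nlinarith)
  have hpp : 0 < p' := by rw [hp']; positivity
  unfold eStar at hle
  set b := q * (1 - e' ^ 2) with hbdef
  set s := Real.sqrt (q ^ 2 * (1 - e' ^ 2) ^ 2 + 4 * p' * Real.cos ω ^ 2 * (p' - b)) with hs
  have hs0 : 0 ≤ s := Real.sqrt_nonneg _
  rw [le_div_iff₀ (by linarith)] at hle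
  have hD : 0 < p' - b := by
    have : 0 < e * (b + s) := by positivity
    linarith
  have hss : s ^ 2 = b ^ 2 + 4 * (p' * c ^ 2) * (p' - b) := by
    rw [hs, Real.sq_sqrt (by positivity), hbdef]; ring
  have key := aux_poly (p' * c ^ 2) b (p' - b) s e hD hs0 hpos hss hle
  have hden : 0 < 1 + e * c := by positivity
  rw [sub_pos, div_lt_iff₀ hden]
  have hQp : p' = Q' * (1 - e') := by
    rw [hp', hQ']; field_simp [(by linarith : (1 - e' : ℝ) ≠ 0)]
  have hQ : 0 < Q' := by rw [hQ']; apply div_pos <;> nlinarith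
  have h1 : q * (1 + e) * (1 + e') * (1 - e') ≤ Q' * (1 - c * e) * (1 + c * e) * (1 - e') := by
    rw [hbdef] at key
    rw [hQp] at key
    nlinarith
  have h2 := le_of_mul_le_mul_right h1 (by linarith)
  have h3 : Q' * (1 - c * e) * (1 + c * e) ≤ Q' * (1 + e * c) := by
    have : 0 ≤ Q' * (1 + e * c) * (e * c) := by positivity
    nlinarith
  have h4 : 0 < q * (1 + e) * e' := by positivity
  nlinarith

theorem aux_zero (q' e' p' Q' q ω : ℝ) (hq' : 0 < q') (he0 : 0 < e') (he1 : e' < 1)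
    (hp' : p' = q' * (1 + e')) (hQ' : Q' = q' * (1 + e') / (1 - e')) (hq : 0 < q)
    (h : q = Q') : eHat p' e' q ω = 0 := by
  have hQp : p' = q * (1 - e') := by
    rw [h, hp', hQ']; field_simp [(by linarith : (1 - e' : ℝ) ≠ 0)]
  have hb : 0 < q * (1 - e' ^ 2) := mul_pos hq (by nlinarith)
  have : eStar p' e' q ω ≤ 0 := by
    unfold eStar
    apply div_nonpos_of_nonpos_of_nonneg
    · rw [hQp]
      have : 0 < q * (1 - e') * e' := by
        have : 0 < 1 - e' := by linarith
        positivity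
      nlinarith
    · have := Real.sqrt_nonneg (q ^ 2 * (1 - e' ^ 2) ^ 2 + 4 * p' * Real.cos ω ^ 2 * (p' - q * (1 - e' ^ 2)))
      linarith
  unfold eHat
  exact max_eq_left ((min_le_left _ _).trans this)

/-- `u^ω_link(q,ω) = 0` iff `q' - 2q/(1-cos ω) = 0` or `q = Q'`; moreover if `q = Q'` then
`u^ω_link = Q' - q = 0`, and if `2q/(1-cos ω) = q'` then `u^ω_link = 2q/(1-cos ω) - q' = 0`. -/
theorem uLinkOm_eq_zero_iff (q' e' : ℝ) (hq' : 0 < q') (he' : e' ∈ Ioo (0 : ℝ) 1)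
    (p' Q' : ℝ) (hp' : p' = q' * (1 + e')) (hQ' : Q' = q' * (1 + e') / (1 - e'))
    (q ω : ℝ) (hq : 0 < q) (hω : ω ∈ Icc 0 (π / 2)) :
    (uLinkOm q' e' p' Q' q ω = 0 ↔
      ((q' : EReal) - equot (2 * q) (1 - Real.cos ω) = 0 ∨ q = Q')) ∧
    (q = Q' → uLinkOm q' e' p' Q' q ω = ((Q' - q : ℝ) : EReal)) ∧
    (equot (2 * q) (1 - Real.cos ω) = ((q' : ℝ) : EReal) →
      uLinkOm q' e' p' Q' q ω = equot (2 * q) (1 - Real.cos ω) - ((q' : ℝ) : EReal)) := by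
  obtain ⟨he0, he1⟩ := he'
  have hc0 : 0 ≤ Real.cos ω :=
    Real.cos_nonneg_of_mem_Icc ⟨by linarith [hω.1, Real.pi_pos], hω.2⟩
  have hc1 : Real.cos ω ≤ 1 := Real.cos_le_one ω
  have hpos := aux_pos q' e' p' Q' q ω hq' he0 he1 hp' hQ' hq hc0
  have hzero := aux_zero q' e' p' Q' q ω hq' he0 he1 hp' hQ' hq
  have hnn : 0 ≤ eHat p' e' q ω := le_max_left _ _
  have hQq : q' < Q' := by
    rw [hQ', lt_div_iff₀ (by linarith)]
    nlinarith
  have hA0 : eHat p' e' q ω = 0 →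
      Q' - q * (1 + eHat p' e' q ω) / (1 + eHat p' e' q ω * Real.cos ω) = Q' - q := by
    intro h; rw [h]; simp
  unfold uLinkOm
  generalize Q' - q * (1 + eHat p' e' q ω) / (1 + eHat p' e' q ω * Real.cos ω) = A at *
  generalize eHat p' e' q ω = e at *
  have hAq : A = 0 → q = Q' := by
    intro h
    rcases hnn.eq_or_lt with h0 | h0
    · have := hA0 h0.symm; linarith
    · exact absurd h (hpos h0).ne'
  have hqA : q = Q' → A = 0 := by
    intro h; rw [hA0 (hzero h)]; linarith
  clear hω
  by_cases hc : 1 - Real.cos ω = 0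
  · have htop : equot (2 * q) (1 - Real.cos ω) = ⊤ := if_pos hc
    rw [htop, EReal.top_sub_coe, min_eq_left le_top]
    refine ⟨⟨fun h => Or.inr (hAq (by exact_mod_cast h)), ?_⟩, ?_, ?_⟩
    · rintro (h | h)
      · simp at h
      · exact_mod_cast hqA h
    · intro h
      rw [hqA h, h, sub_self]
    · intro h; simp at h
  · have hval : equot (2 * q) (1 - Real.cos ω) = ((2 * q / (1 - Real.cos ω) : ℝ) : EReal) :=
      if_neg hc
    have hcp : 0 < 1 - Real.cos ω := lt_of_le_of_ne (by linarith) (Ne.symm hc)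
    have hX : 2 * q ≤ 2 * q / (1 - Real.cos ω) := by
      rw [le_div_iff₀ hcp]
      nlinarith [mul_nonneg hq.le hc0]
    have hmin : ∀ x y : ℝ, min (x : EReal) (y : EReal) = ((min x y : ℝ) : EReal) :=
      fun x y => (EReal.coe_strictMono.monotone.map_min).symm
    rw [hval]
    generalize 2 * q / (1 - Real.cos ω) = X at *
    have hXA : X = q' → 0 ≤ A := by
      intro h
      rcases hnn.eq_or_lt with h0 | h0
      · have := hA0 h0.symm; linarith
      · exact (hpos h0).le
    rw [← EReal.coe_sub, hmin]
    norm_cast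
    refine ⟨⟨?_, ?_⟩, ?_, ?_⟩
    · intro h
      rcases min_choice A (X - q') with h1 | h1
      · exact Or.inr (hAq (h1 ▸ h))
      · left; rw [h1] at h; linarith
    · rintro (h | h)
      · have : X = q' := by linarith
        rw [min_eq_right (by linarith [hXA this])]; linarith
      · rw [hqA h, min_eq_left (by linarith)]
    · intro h
      rw [hqA h, min_eq_left (by linarith)]; linarith
    · intro h
      rw [min_eq_right (by linarith [hXA h])]
end
end

section
/- Fix q' > 0 and e' ∈ (0,1). There is no pair (q,ω) with q > 0 and ω ∈ [0,π/2] such that δ_link(q,e,ω,ω') > 0 for every (e,ω') ∈ [0,1] × [0,π]; that is, for no (q,ω) are the two trajectories topologically linked for all choices of (e,ω'). -/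
open Real Set Filter Topology

noncomputable section

/-- There is no `(q, ω)` with `q > 0`, `ω ∈ [0,π/2]` such that the orbits are topologically
linked (`δ_link > 0`) for every `(e, ω') ∈ [0,1] × [0,π]`. -/
theorem no_always_linked_qom (q' e' : ℝ) (hq' : 0 < q') (he' : e' ∈ Ioo (0 : ℝ) 1) :
    ¬ ∃ q ω : ℝ, 0 < q ∧ ω ∈ Icc 0 (π / 2) ∧
      ∀ e ∈ Icc (0 : ℝ) 1, ∀ ω' ∈ Icc (0 : ℝ) π, 0 < deltaLink q' e' q e ω ω' := by
  rintro ⟨q, ω, hq, hω, h⟩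
  have h1 := h 0 (by simp) (π / 2) ⟨by positivity, by linarith [Real.pi_pos]⟩
  have key : dminus q' e' q 0 ω (π / 2) = dplus q' e' q 0 ω (π / 2) := by
    simp [dminus, dplus, rplus, rminus]
  unfold deltaLink at h1
  rw [key] at h1
  generalize dplus q' e' q 0 ω (π / 2) = x at h1
  have h2 : 0 < x ∧ 0 < -x := by
    rcases lt_max_iff.1 h1 with h3 | h3
    · exact (lt_min_iff.1 h3).symm
    · exact lt_min_iff.1 h3
  have h4 : x < 0 := by
    have := EReal.neg_lt_neg_iff.2 h2.2
    simpa using this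
  exact lt_asymm h2.1 h4
end
end

section
/- Fix q' > 0 and e' ∈ (0,1), and let Q' = q'(1+e')/(1−e'). For every (q,e) with q > 0 and e ∈ [0,1], the minimum of the nodal distance δ_nod(q,e,ω,ω') over (ω,ω') ∈ D₃ = [0,π/2] × [0,π] equals max{0, ℓ^e_int(q,e), ℓ^e_ext(q,e)}, where ℓ^e_int(q,e) = q' − q(1+e)/(1−e) (interpreted as −∞ when e = 1) and ℓ^e_ext(q,e) = q − Q'. -/
open Real Set Filter Topology

noncomputable section

lemma aux_scale (e x : ℝ) (h0 : 0 ≤ x) (h1 : x ≤ e) : ∃ c, 0 ≤ c ∧ c ≤ 1 ∧ e * c = x := by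
  rcases eq_or_lt_of_le (h0.trans h1) with h | h
  · exact ⟨0, le_rfl, zero_le_one, by simp; linarith⟩
  · exact ⟨x / e, by positivity, by rw [div_le_one h]; exact h1, by field_simp⟩

lemma aux_equot (a b r : ℝ) (hr : 0 < r) (ha : 0 < a) (h : b = a / r) : equot a b = (r : EReal) := by
  have hb : b ≠ 0 := by rw [h]; positivity
  rw [equot, if_neg hb, h]
  congr 1
  field_simp

lemma aux_abs (s r : ℝ) : max ((s : EReal) - r) (-((s : EReal) - r)) = ((|s - r| : ℝ) : EReal) := by
  rw [abs_eq_max_neg, ← EReal.coe_sub, ← EReal.coe_neg]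
  exact (EReal.coe_strictMono.monotone.map_max).symm

lemma aux_attain (q' e' q e r s : ℝ) (hq' : 0 < q') (he' : e' ∈ Ioo (0 : ℝ) 1)
    (hq : 0 < q) (he : e ∈ Icc (0 : ℝ) 1) (h1 : q ≤ r) (h2 : r * (1 - e) ≤ q * (1 + e))
    (h3 : q' ≤ s) (h4 : s * (1 - e') ≤ q' * (1 + e')) :
    ∃ ω ∈ Icc 0 (π / 2), ∃ ω' ∈ Icc 0 π, deltaNod q' e' q e ω ω' ≤ ((|s - r| : ℝ) : EReal) := by
  obtain ⟨he0, he1⟩ := he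
  obtain ⟨he0', he1'⟩ := he'
  have hr : 0 < r := by linarith
  have hs : 0 < s := by linarith
  have hp : 0 < q * (1 + e) := by positivity
  have hp' : 0 < q' * (1 + e') := by positivity
  set x' := (q' * (1 + e') / s - 1) / e' with hx'
  have hxe : e' * x' = q' * (1 + e') / s - 1 := by rw [hx']; field_simp
  have b1 : q' * (1 + e') / s ≤ 1 + e' := by rw [div_le_iff₀ hs]; nlinarith
  have b2 : 1 - e' ≤ q' * (1 + e') / s := by rw [le_div_iff₀ hs]; nlinarith
  have hx1 : x' ≤ 1 := by rw [hx', div_le_one he0']; linarith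
  have hx2 : -1 ≤ x' := by rw [hx', le_div_iff₀ he0']; linarith
  have b3 : q * (1 + e) / r ≤ 1 + e := by rw [div_le_iff₀ hr]; nlinarith
  have b4 : 1 - e ≤ q * (1 + e) / r := by rw [le_div_iff₀ hr]; nlinarith
  rcases le_total 1 (q * (1 + e) / r) with h | h
  · obtain ⟨c, c0, c1, hc⟩ := aux_scale e (q * (1 + e) / r - 1) (by linarith) (by linarith)
    refine ⟨arccos c, ⟨arccos_nonneg _, arccos_le_pi_div_two.2 c0⟩, arccos x',
      ⟨arccos_nonneg _, arccos_le_pi _⟩, ?_⟩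
    refine (min_le_left _ _).trans (le_of_eq ?_)
    rw [dplus, rplus, cos_arccos (by linarith) c1, cos_arccos hx2 hx1,
      aux_equot _ _ r hr hp (by linarith), aux_equot _ _ s hs hp' (by linarith), aux_abs]
  · obtain ⟨c, c0, c1, hc⟩ := aux_scale e (1 - q * (1 + e) / r) (by linarith) (by linarith)
    refine ⟨arccos c, ⟨arccos_nonneg _, arccos_le_pi_div_two.2 c0⟩, arccos (-x'),
      ⟨arccos_nonneg _, arccos_le_pi _⟩, ?_⟩
    refine (min_le_right _ _).trans (le_of_eq ?_)
    rw [dminus, rminus, cos_arccos (by linarith) c1, cos_arccos (by linarith) (by linarith),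
      aux_equot _ _ r hr hp (by linarith), aux_equot _ _ s hs hp' (by linarith), aux_abs]

/-- bounds of the radius for `x ∈ [-1,1]`. -/
lemma aux_bounds (q e x : ℝ) (hq : 0 < q) (he : e ∈ Icc (0 : ℝ) 1) (hx : -1 ≤ x) (hx1 : x ≤ 1) :
    (q : EReal) ≤ equot (q * (1 + e)) (1 + e * x) ∧
    equot (q * (1 + e)) (1 + e * x) ≤ equot (q * (1 + e)) (1 - e) := by
  obtain ⟨he0, he1⟩ := he
  have k1 : 1 - e ≤ 1 + e * x := by nlinarith
  have k2 : 1 + e * x ≤ 1 + e := by nlinarith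
  have hp : 0 < q * (1 + e) := by positivity
  constructor
  · unfold equot
    split_ifs with h
    · exact le_top
    · have : 0 < 1 + e * x := lt_of_le_of_ne (by linarith) (Ne.symm h)
      rw [EReal.coe_le_coe_iff, le_div_iff₀ this]
      nlinarith
  · by_cases h : 1 - e = 0
    · simp [equot, h]
    · have h' : 0 < 1 - e := lt_of_le_of_ne (by linarith) (Ne.symm h)
      have : 0 < 1 + e * x := by linarith
      rw [equot, equot, if_neg h, if_neg this.ne', EReal.coe_le_coe_iff]
      gcongr

lemma aux_lower (q' Q' q : ℝ) (Q s r : EReal) (h1 : (q : EReal) ≤ r) (h2 : r ≤ Q)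
    (h3 : (q' : EReal) ≤ s) (h4 : s ≤ Q') :
    max 0 (max ((q' : EReal) - Q) (((q - Q' : ℝ) : EReal))) ≤ max (s - r) (-(s - r)) := by
  refine max_le ?_ (max_le ?_ ?_)
  · rcases le_total 0 (s - r) with h | h
    · exact h.trans (le_max_left _ _)
    · exact (EReal.neg_nonneg.2 h).trans (le_max_right _ _)
  · exact (EReal.sub_le_sub h3 h2).trans (le_max_left _ _)
  · refine le_trans ?_ (le_max_right _ _)
    have : s - r ≤ ((Q' - q : ℝ) : EReal) := by
      rw [EReal.coe_sub]; exact EReal.sub_le_sub h4 h1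
    have h := EReal.neg_le_neg_iff.2 this
    rw [← EReal.coe_neg, neg_sub] at h
    exact h

/-- Optimal lower bound for `δ_nod` as a function of `(q, e)`: the minimum over
`(ω, ω') ∈ [0,π/2] × [0,π]` equals `max{0, ℓ^e_int, ℓ^e_ext}`, where
`ℓ^e_int = q' - q(1+e)/(1-e)` (which is `-∞` when `e = 1`) and `ℓ^e_ext = q - Q'`. -/
theorem deltaNod_min_qe (q' e' : ℝ) (hq' : 0 < q') (he' : e' ∈ Ioo (0 : ℝ) 1)
    (Q' : ℝ) (hQ' : Q' = q' * (1 + e') / (1 - e'))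
    (q e : ℝ) (hq : 0 < q) (he : e ∈ Icc (0 : ℝ) 1) :
    IsLeast ((fun pr : ℝ × ℝ => deltaNod q' e' q e pr.1 pr.2) '' (Icc 0 (π / 2) ×ˢ Icc 0 π))
      (max 0 (max ((q' : EReal) - equot (q * (1 + e)) (1 - e))
        (((q - Q' : ℝ) : EReal)))) := by
  have hE' : e' ∈ Icc (0 : ℝ) 1 := ⟨he'.1.le, he'.2.le⟩
  have h1e' : 0 < 1 - e' := by linarith [he'.2]
  have hQe : equot (q' * (1 + e')) (1 - e') = (Q' : EReal) := by
    rw [equot, if_neg h1e'.ne', hQ']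
  have hQm : Q' * (1 - e') = q' * (1 + e') := by rw [hQ']; field_simp
  have hqQ : q' ≤ Q' := by
    rw [hQ', le_div_iff₀ h1e']; nlinarith [he'.1]
  have lower : ∀ ω ω' : ℝ, max 0 (max ((q' : EReal) - equot (q * (1 + e)) (1 - e))
        (((q - Q' : ℝ) : EReal))) ≤ deltaNod q' e' q e ω ω' := by
    intro ω ω'
    have a1 := aux_bounds q e (cos ω) hq he (neg_one_le_cos _) (cos_le_one _)
    have a2 := aux_bounds q e (-cos ω) hq he (by linarith [cos_le_one ω])
      (by linarith [neg_one_le_cos ω])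
    have a3 := aux_bounds q' e' (cos ω') hq' hE' (neg_one_le_cos _) (cos_le_one _)
    have a4 := aux_bounds q' e' (-cos ω') hq' hE' (by linarith [cos_le_one ω'])
      (by linarith [neg_one_le_cos ω'])
    rw [hQe] at a3 a4
    rw [mul_neg, ← sub_eq_add_neg] at a2 a4
    exact le_min (aux_lower _ _ _ _ _ _ a1.1 a1.2 a3.1 a3.2)
      (aux_lower _ _ _ _ _ _ a2.1 a2.2 a4.1 a4.2)
  refine ⟨?_, ?_⟩
  swap
  · rintro _ ⟨⟨ω, ω'⟩, -, rfl⟩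
    exact lower ω ω'
  suffices H : ∃ r s : ℝ, q ≤ r ∧ r * (1 - e) ≤ q * (1 + e) ∧ q' ≤ s ∧
      s * (1 - e') ≤ q' * (1 + e') ∧ ((|s - r| : ℝ) : EReal) ≤
        max 0 (max ((q' : EReal) - equot (q * (1 + e)) (1 - e)) (((q - Q' : ℝ) : EReal))) by
    obtain ⟨r, s, h1, h2, h3, h4, h5⟩ := H
    obtain ⟨ω, hω, ω', hω', h⟩ := aux_attain q' e' q e r s hq' he' hq he h1 h2 h3 h4
    exact ⟨(ω, ω'), ⟨hω, hω'⟩, le_antisymm (h.trans h5) (lower ω ω')⟩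
  obtain ⟨he0, he1⟩ := he
  have hqe : q * (1 - e) ≤ q * (1 + e) := by nlinarith
  by_cases c1 : Q' ≤ q
  · refine ⟨q, Q', le_rfl, hqe, hqQ, hQm.le, ?_⟩
    rw [abs_sub_comm, abs_of_nonneg (by linarith)]
    exact (le_max_right _ _).trans (le_max_right _ _)
  push Not at c1
  by_cases c2 : q' * (1 - e) ≤ q * (1 + e)
  · refine ⟨max q q', max q q', le_max_left _ _, ?_, le_max_right _ _, ?_, ?_⟩
    · rcases max_choice q q' with h | h <;> rw [h] <;> assumption
    · rw [← hQm]
      exact mul_le_mul_of_nonneg_right (max_le c1.le hqQ) h1e'.le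
    · simp
  · push Not at c2
    have h1e : 0 < 1 - e := by
      by_contra h
      have : 0 < q * (1 + e) := by positivity
      nlinarith
    refine ⟨q * (1 + e) / (1 - e), q', ?_, ?_, le_rfl, ?_, ?_⟩
    · rw [le_div_iff₀ h1e]; exact hqe
    · rw [div_mul_cancel₀ _ h1e.ne']
    · nlinarith [he'.1]
    · have : q * (1 + e) / (1 - e) ≤ q' := by rw [div_le_iff₀ h1e]; exact c2.le
      rw [abs_of_nonneg (by linarith), equot, if_neg h1e.ne', EReal.coe_sub]
      exact (le_max_left _ _).trans (le_max_right _ _)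
end
end

section
/- Fix q' > 0 and e' ∈ (0,1), and let Q' = q'(1+e')/(1−e'). For every q > 0, e ∈ [0,1], ω ∈ [0,π/2] and ω' ∈ [0,π]: δ_int(q,e,ω,ω') ≥ δ_int(q,e,0,π) = q' − q(1+e)/(1−e), and δ_ext(q,e,ω,ω') ≥ δ_ext(q,e,0,π) = q − Q'. -/
open Real Set Filter Topology

noncomputable section

theorem equot_anti_aux {a b c : ℝ} (ha : 0 < a) (hb : 0 ≤ b) (hbc : b ≤ c) :
    equot a c ≤ equot a b := by
  unfold equot
  by_cases h : b = 0
  · simp [h]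
  · have hb' : 0 < b := lt_of_le_of_ne hb (Ne.symm h)
    have hc : c ≠ 0 := (lt_of_lt_of_le hb' hbc).ne'
    rw [if_neg h, if_neg hc]
    exact EReal.coe_le_coe_iff.2 (div_le_div_of_nonneg_left ha.le hb' hbc)

theorem equot_self_aux {q e : ℝ} (he : 0 ≤ e) : equot (q * (1 + e)) (1 + e) = (q : EReal) := by
  have h : 1 + e ≠ 0 := by positivity
  unfold equot
  rw [if_neg h, mul_div_assoc, div_self h, mul_one]

theorem equot_bounds_aux {q e c : ℝ} (hq : 0 < q) (he : 0 ≤ e) (he1 : e ≤ 1)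
    (hc : -1 ≤ c) (hc1 : c ≤ 1) :
    (q : EReal) ≤ equot (q * (1 + e)) (1 + e * c) ∧
    equot (q * (1 + e)) (1 + e * c) ≤ equot (q * (1 + e)) (1 - e) := by
  have ha : 0 < q * (1 + e) := by positivity
  constructor
  · have := he
    conv_lhs => rw [← equot_self_aux (q := q) he]
    exact equot_anti_aux ha (by nlinarith) (by nlinarith)
  · exact equot_anti_aux ha (by linarith) (by nlinarith)

/-- Lower bounds: `δ_int(q,e,ω,ω') ≥ δ_int(q,e,0,π) = q' - q(1+e)/(1-e)` and
`δ_ext(q,e,ω,ω') ≥ δ_ext(q,e,0,π) = q - Q'`. -/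
theorem deltaInt_deltaExt_lower_bounds_qe (q' e' : ℝ) (hq' : 0 < q')
    (he' : e' ∈ Ioo (0 : ℝ) 1) (Q' : ℝ) (hQ' : Q' = q' * (1 + e') / (1 - e'))
    (q e : ℝ) (hq : 0 < q) (he : e ∈ Icc (0 : ℝ) 1) :
    (∀ ω ∈ Icc (0 : ℝ) (π / 2), ∀ ω' ∈ Icc (0 : ℝ) π,
      deltaInt q' e' q e 0 π ≤ deltaInt q' e' q e ω ω') ∧
    deltaInt q' e' q e 0 π = (q' : EReal) - equot (q * (1 + e)) (1 - e) ∧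
    (∀ ω ∈ Icc (0 : ℝ) (π / 2), ∀ ω' ∈ Icc (0 : ℝ) π,
      deltaExt q' e' q e 0 π ≤ deltaExt q' e' q e ω ω') ∧
    deltaExt q' e' q e 0 π = ((q - Q' : ℝ) : EReal) := by
  obtain ⟨he0, he1⟩ := he
  obtain ⟨hp0, hp1⟩ := he'
  have hQ : equot (q' * (1 + e')) (1 - e') = (Q' : EReal) := by
    unfold equot
    rw [if_neg (by linarith), hQ']
  have B1 : ∀ c : ℝ, -1 ≤ c → c ≤ 1 → _ := fun c h1 h2 => equot_bounds_aux (c := c) hq he0 he1 h1 h2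
  have B2 : ∀ c : ℝ, -1 ≤ c → c ≤ 1 → _ :=
    fun c h1 h2 => equot_bounds_aux (c := c) hq' hp0.le hp1.le h1 h2
  rw [hQ] at B2
  have P : dplus q' e' q e 0 π = (Q' : EReal) - q := by
    simp only [dplus, rplus, Real.cos_pi, Real.cos_zero, mul_one, mul_neg, ← sub_eq_add_neg]
    rw [hQ, equot_self_aux he0]
  have M : dminus q' e' q e 0 π = (q' : EReal) - equot (q * (1 + e)) (1 - e) := by
    simp only [dminus, rminus, Real.cos_pi, Real.cos_zero, mul_one, mul_neg, sub_neg_eq_add]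
    rw [equot_self_aux hp0.le]
  have DP : ∀ ω ω', (q' : EReal) - equot (q * (1 + e)) (1 - e) ≤ dplus q' e' q e ω ω' ∧
      dplus q' e' q e ω ω' ≤ (Q' : EReal) - q := by
    intro ω ω'
    obtain ⟨a1, a2⟩ := B1 (cos ω) (neg_one_le_cos ω) (cos_le_one ω)
    obtain ⟨b1, b2⟩ := B2 (cos ω') (neg_one_le_cos ω') (cos_le_one ω')
    exact ⟨EReal.sub_le_sub b1 a2, EReal.sub_le_sub b2 a1⟩
  have DM : ∀ ω ω', (q' : EReal) - equot (q * (1 + e)) (1 - e) ≤ dminus q' e' q e ω ω' ∧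
      dminus q' e' q e ω ω' ≤ (Q' : EReal) - q := by
    intro ω ω'
    obtain ⟨a1, a2⟩ := B1 (-cos ω) (by linarith [cos_le_one ω]) (by linarith [neg_one_le_cos ω])
    obtain ⟨b1, b2⟩ := B2 (-cos ω') (by linarith [cos_le_one ω'])
      (by linarith [neg_one_le_cos ω'])
    rw [mul_neg, ← sub_eq_add_neg] at a1 a2 b1 b2
    exact ⟨EReal.sub_le_sub b1 a2, EReal.sub_le_sub b2 a1⟩
  have I : deltaInt q' e' q e 0 π = (q' : EReal) - equot (q * (1 + e)) (1 - e) := by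
    unfold deltaInt
    rw [min_eq_right (by rw [M]; exact (DP 0 π).1), M]
  have E : deltaExt q' e' q e 0 π = -((Q' : EReal) - q) := by
    unfold deltaExt
    rw [min_eq_left (by rw [P]; exact EReal.neg_le_neg_iff.2 (DM 0 π).2), P]
  refine ⟨fun ω _ ω' _ => ?_, I, fun ω _ ω' _ => ?_, ?_⟩
  · rw [I]
    exact le_min (DP ω ω').1 (DM ω ω').1
  · rw [E]
    exact le_min (EReal.neg_le_neg_iff.2 (DP ω ω').2) (EReal.neg_le_neg_iff.2 (DM ω ω').2)
  · rw [E, ← EReal.coe_sub, ← EReal.coe_neg, neg_sub]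
end
end

section
/- Let p, p' > 0 and define, for (ξ,ξ') ∈ D = (−1,1) × (−1,1), the function D(ξ,ξ') = min{ p'/(1+ξ') − p/(1+ξ), p'/(1−ξ') − p/(1−ξ) }. Then the supremum of D over D equals p' − p if p' ≥ p, in which case it is attained at (ξ,ξ') = (0,0); and it equals (p' − p)/2 if p' < p, in which case it is not attained but equals the limsup of D as (ξ,ξ') → (1,1) and as (ξ,ξ') → (−1,−1). -/
open Real Set Filter Topology

noncomputable section

/-- The function `D(ξ,ξ') = min{ p'/(1+ξ') - p/(1+ξ), p'/(1-ξ') - p/(1-ξ) }`. -/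
noncomputable def Dfun (p p' ξ ξ' : ℝ) : ℝ :=
  min (p' / (1 + ξ') - p / (1 + ξ)) (p' / (1 - ξ') - p / (1 - ξ))

lemma Dfun_neg (p p' x y : ℝ) : Dfun p p' (-x) (-y) = Dfun p p' x y := by
  unfold Dfun
  rw [min_comm]
  simp only [sub_neg_eq_add, ← sub_eq_add_neg]

lemma Dfun_half (p p' x y : ℝ) (hp : 0 < p) (hp' : 0 < p') (h : p ≤ p')
    (hx : -1 < x) (hy : -1 < y) (hc : p * x ≤ p' * y) :
    p' / (1 + y) - p / (1 + x) ≤ p' - p := by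
  have hq : 0 < p' + p * x := by nlinarith
  have h1x : 0 < 1 + x := by linarith
  have h1 : p' / (1 + y) ≤ p' ^ 2 / (p' + p * x) := by
    rw [div_le_div_iff₀ (by linarith) hq]
    nlinarith
  have h2 : p' - p - (p' ^ 2 / (p' + p * x) - p / (1 + x))
      = p * x ^ 2 * (p' - p) / ((p' + p * x) * (1 + x)) := by
    field_simp
    ring
  have h3 : 0 ≤ p * x ^ 2 * (p' - p) / ((p' + p * x) * (1 + x)) := by
    have : 0 ≤ p' - p := by linarith
    positivity
  linarith

lemma Dfun_half' (p p' x y : ℝ) (hp' : 0 < p') (h : p' < p)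
    (hx : -1 < x) (hx1 : x < 1) (hc : x ≤ y) :
    p' / (1 + y) - p / (1 + x) < (p' - p) / 2 := by
  have h1x : 0 < 1 + x := by linarith
  have h1 : p' / (1 + y) ≤ p' / (1 + x) := by gcongr
  have h2 : (p - p') / 2 < (p - p') / (1 + x) := by
    apply div_lt_div_of_pos_left <;> linarith
  have h3 : (p - p') / (1 + x) = p / (1 + x) - p' / (1 + x) := by ring
  linarith

lemma Dfun_le (p p' x y : ℝ) (hp : 0 < p) (hp' : 0 < p') (h : p ≤ p')
    (hx : x ∈ Ioo (-1 : ℝ) 1) (hy : y ∈ Ioo (-1 : ℝ) 1) : Dfun p p' x y ≤ p' - p := by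
  rcases le_total (p * x) (p' * y) with hc | hc
  · exact (min_le_left _ _).trans (Dfun_half p p' x y hp hp' h hx.1 hy.1 hc)
  · rw [← Dfun_neg]
    exact (min_le_left _ _).trans (Dfun_half p p' (-x) (-y) hp hp' h (by linarith [hx.2])
      (by linarith [hy.2]) (by linarith))

lemma Dfun_lt (p p' x y : ℝ) (hp' : 0 < p') (h : p' < p)
    (hx : x ∈ Ioo (-1 : ℝ) 1) : Dfun p p' x y < (p' - p) / 2 := by
  rcases le_total x y with hc | hc
  · exact (min_le_left _ _).trans_lt (Dfun_half' p p' x y hp' h hx.1 hx.2 hc)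
  · rw [← Dfun_neg]
    exact (min_le_left _ _).trans_lt (Dfun_half' p p' (-x) (-y) hp' h (by linarith [hx.2])
      (by linarith [hx.1]) (by linarith))

lemma Dfun_path (p p' a : ℝ) (hp : 0 < p) (hp' : 0 < p') (h : p' < p) (ha : a < (p' - p) / 2) :
    ∀ᶠ t in 𝓝[>] (0 : ℝ), a < Dfun p p' (1 - t) (1 - p' / (2 * p) * t) := by
  have hc : ContinuousAt (fun t : ℝ => p' / (1 + (1 - p' / (2 * p) * t)) - p / (1 + (1 - t))) 0 := by
    apply ContinuousAt.sub
    · exact ContinuousAt.div (by fun_prop) (by fun_prop) (by norm_num)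
    · exact ContinuousAt.div (by fun_prop) (by fun_prop) (by norm_num)
  have h1 := (hc.tendsto.mono_left (nhdsWithin_le_nhds (s := Ioi 0))).eventually
    (lt_mem_nhds (a := a) (by norm_num; linarith))
  filter_upwards [h1, self_mem_nhdsWithin] with t ht ht0
  have ht0 : 0 < t := ht0
  refine lt_min ht ?_
  have : p' / (1 - (1 - p' / (2 * p) * t)) - p / (1 - (1 - t)) = p / t := by
    rw [sub_sub_cancel, sub_sub_cancel]
    field_simp
    ring
  rw [this]
  have : 0 < p / t := by positivity
  linarith

lemma Dfun_path_mem (p p' : ℝ) (hp : 0 < p) (hp' : 0 < p') (h : p' < p) :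
    ∀ᶠ t in 𝓝[>] (0 : ℝ), 1 - t ∈ Ioo (-1 : ℝ) 1 ∧ 1 - p' / (2 * p) * t ∈ Ioo (-1 : ℝ) 1 := by
  filter_upwards [Ioo_mem_nhdsGT (show (0 : ℝ) < 1 by norm_num)] with t ht
  have hk : 0 < p' / (2 * p) := by positivity
  have hk1 : p' / (2 * p) < 1 := by rw [div_lt_one (by positivity)]; linarith
  have := mul_pos hk ht.1
  have : p' / (2 * p) * t < 1 := by nlinarith [ht.1, ht.2]
  refine ⟨⟨?_, ?_⟩, ⟨?_, ?_⟩⟩ <;> linarith [ht.1, ht.2]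

lemma Dfun_low1 (p p' a : ℝ) (hp : 0 < p) (hp' : 0 < p') (h : p' < p)
    (ha : ∀ᶠ x in 𝓝[(Ioo (-1 : ℝ) 1 ×ˢ Ioo (-1 : ℝ) 1)] (((1 : ℝ), (1 : ℝ))),
      Dfun p p' x.1 x.2 ≤ a) : (p' - p) / 2 ≤ a := by
  by_contra! hlt
  have ht : Tendsto (fun t : ℝ => ((1 - t, 1 - p' / (2 * p) * t) : ℝ × ℝ)) (𝓝[>] 0)
      (𝓝[(Ioo (-1 : ℝ) 1 ×ˢ Ioo (-1 : ℝ) 1)] (((1 : ℝ), (1 : ℝ)))) := by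
    apply tendsto_nhdsWithin_of_tendsto_nhds_of_eventually_within
    · have hc : Continuous (fun t : ℝ => ((1 - t, 1 - p' / (2 * p) * t) : ℝ × ℝ)) := by fun_prop
      have := hc.tendsto 0
      simp only [mul_zero, sub_zero] at this
      exact this.mono_left nhdsWithin_le_nhds
    · exact Dfun_path_mem p p' hp hp' h
  obtain ⟨t, h1, h2⟩ := ((ht.eventually ha).and (Dfun_path p p' a hp hp' h hlt)).exists
  exact absurd h1 (not_le.mpr h2)

lemma Dfun_low2 (p p' a : ℝ) (hp : 0 < p) (hp' : 0 < p') (h : p' < p)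
    (ha : ∀ᶠ x in 𝓝[(Ioo (-1 : ℝ) 1 ×ˢ Ioo (-1 : ℝ) 1)] (((-1 : ℝ), (-1 : ℝ))),
      Dfun p p' x.1 x.2 ≤ a) : (p' - p) / 2 ≤ a := by
  apply Dfun_low1 p p' a hp hp' h
  have ht : Tendsto (fun x : ℝ × ℝ => ((-x.1, -x.2) : ℝ × ℝ))
      (𝓝[(Ioo (-1 : ℝ) 1 ×ˢ Ioo (-1 : ℝ) 1)] (((1 : ℝ), (1 : ℝ))))
      (𝓝[(Ioo (-1 : ℝ) 1 ×ˢ Ioo (-1 : ℝ) 1)] (((-1 : ℝ), (-1 : ℝ)))) := by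
    apply tendsto_nhdsWithin_of_tendsto_nhds_of_eventually_within
    · have hc : Continuous (fun x : ℝ × ℝ => ((-x.1, -x.2) : ℝ × ℝ)) := by fun_prop
      exact (hc.tendsto (1, 1)).mono_left nhdsWithin_le_nhds
    · filter_upwards [self_mem_nhdsWithin] with x hx
      obtain ⟨⟨h1, h2⟩, ⟨h3, h4⟩⟩ := hx
      refine ⟨⟨?_, ?_⟩, ⟨?_, ?_⟩⟩ <;> simp only <;> linarith
  filter_upwards [ht.eventually ha] with x hx
  rwa [Dfun_neg] at hx

lemma limsup_aux (f : ℝ × ℝ → ℝ) (F : Filter (ℝ × ℝ)) (c : ℝ) (h1 : ∀ᶠ x in F, f x ≤ c)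
    (h2 : ∀ a, (∀ᶠ x in F, f x ≤ a) → c ≤ a) : limsup f F = c := by
  rw [limsup_eq]
  exact IsLeast.csInf_eq ⟨h1, fun a ha => h2 a ha⟩

/-- On the open square `(-1,1) × (-1,1)`: if `p' ≥ p` the supremum of `D` is `p' - p`,
attained at `(0,0)`; if `p' < p` the supremum is `(p' - p)/2`, not attained, and it equals
the limsup of `D` as `(ξ,ξ') → (1,1)` and as `(ξ,ξ') → (-1,-1)` within the square. -/
theorem Dfun_sup (p p' : ℝ) (hp : 0 < p) (hp' : 0 < p') :
    (p ≤ p' →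
      IsGreatest ((fun x : ℝ × ℝ => Dfun p p' x.1 x.2) '' (Ioo (-1 : ℝ) 1 ×ˢ Ioo (-1 : ℝ) 1))
        (p' - p) ∧
      Dfun p p' 0 0 = p' - p) ∧
    (p' < p →
      sSup ((fun x : ℝ × ℝ => Dfun p p' x.1 x.2) '' (Ioo (-1 : ℝ) 1 ×ˢ Ioo (-1 : ℝ) 1)) =
        (p' - p) / 2 ∧
      (p' - p) / 2 ∉
        ((fun x : ℝ × ℝ => Dfun p p' x.1 x.2) '' (Ioo (-1 : ℝ) 1 ×ˢ Ioo (-1 : ℝ) 1)) ∧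
      Filter.limsup (fun x : ℝ × ℝ => Dfun p p' x.1 x.2)
        (𝓝[(Ioo (-1 : ℝ) 1 ×ˢ Ioo (-1 : ℝ) 1)] (((1 : ℝ), (1 : ℝ)))) = (p' - p) / 2 ∧
      Filter.limsup (fun x : ℝ × ℝ => Dfun p p' x.1 x.2)
        (𝓝[(Ioo (-1 : ℝ) 1 ×ˢ Ioo (-1 : ℝ) 1)] (((-1 : ℝ), (-1 : ℝ)))) = (p' - p) / 2) := by
  have h00 : Dfun p p' 0 0 = p' - p := by simp [Dfun]
  refine ⟨fun h => ⟨⟨⟨(0, 0), by simp, h00⟩, ?_⟩, h00⟩, fun h => ⟨?_, ?_, ?_, ?_⟩⟩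
  · rintro _ ⟨x, hx, rfl⟩
    exact Dfun_le p p' _ _ hp hp' h hx.1 hx.2
  · apply IsLUB.csSup_eq
    · refine ⟨?_, fun a ha => ?_⟩
      · rintro _ ⟨x, hx, rfl⟩
        exact (Dfun_lt p p' _ _ hp' h hx.1).le
      · apply Dfun_low1 p p' a hp hp' h
        filter_upwards [self_mem_nhdsWithin] with x hx
        exact ha ⟨x, hx, rfl⟩
    · exact ⟨_, (0, 0), by simp, rfl⟩
  · rintro ⟨x, hx, he⟩
    exact (Dfun_lt p p' _ _ hp' h hx.1).ne he
  · apply limsup_aux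
    · filter_upwards [self_mem_nhdsWithin] with x hx
      exact (Dfun_lt p p' _ _ hp' h hx.1).le
    · exact fun a ha => Dfun_low1 p p' a hp hp' h ha
  · apply limsup_aux
    · filter_upwards [self_mem_nhdsWithin] with x hx
      exact (Dfun_lt p p' _ _ hp' h hx.1).le
    · exact fun a ha => Dfun_low2 p p' a hp hp' h ha
end
end

section
/- Fix q' > 0 and e' ∈ (0,1), and let p' = q'(1+e'). For every (q,ω') with q > 0 and ω' ∈ [0,π/2], the minimum of the nodal distance δ_nod(q,e,ω,ω') over (e,ω) ∈ D₅ = [0,1] × [0,π] equals max{0, ℓ^{ω'}_ext(q,ω')}, where ℓ^{ω'}_ext(q,ω') = q − p'/(1−e'·cos ω'). -/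
open Real Set Filter Topology

noncomputable section

lemma abs_nonneg_aux (x : EReal) : 0 ≤ max x (-x) := by
  rcases le_total 0 x with h | h
  · exact le_max_of_le_left h
  · exact le_max_of_le_right (by simpa using EReal.neg_le_neg_iff.2 h)

lemma equot_ge_aux_s16 (q e d : ℝ) (hq : 0 < q) (hd : 0 ≤ d) (hd' : d ≤ 1 + e) :
    (q : EReal) ≤ equot (q * (1 + e)) d := by
  unfold equot
  split_ifs with h
  · exact le_top
  · have : 0 < d := lt_of_le_of_ne hd (Ne.symm h)
    rw [EReal.coe_le_coe_iff, le_div_iff₀ this]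
    exact mul_le_mul_of_nonneg_left hd' hq.le

lemma sub_ge_aux (L a q : ℝ) (r : EReal) (hr : (q : EReal) ≤ r) (hL : L ≤ q - a) :
    (L : EReal) ≤ max ((a : EReal) - r) (-((a : EReal) - r)) := by
  apply le_max_of_le_right
  induction r with
  | bot => simp at hr
  | top => simp
  | coe r =>
    norm_cast at hr ⊢
    linarith

/-- Optimal lower bound for `δ_nod` as a function of `(q, ω')`: the minimum over
`(e, ω) ∈ [0,1] × [0,π]` equals `max{0, ℓ^{ω'}_ext}`, where
`ℓ^{ω'}_ext = q - p'/(1 - e' cos ω')`. -/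
theorem deltaNod_min_qomp (q' e' : ℝ) (hq' : 0 < q') (he' : e' ∈ Ioo (0 : ℝ) 1)
    (p' : ℝ) (hp' : p' = q' * (1 + e'))
    (q ω' : ℝ) (hq : 0 < q) (hω' : ω' ∈ Icc 0 (π / 2)) :
    IsLeast ((fun pr : ℝ × ℝ => deltaNod q' e' q pr.1 pr.2 ω') '' (Icc 0 1 ×ˢ Icc 0 π))
      (max 0 (((q - p' / (1 - e' * Real.cos ω') : ℝ) : EReal))) := by
  obtain ⟨he0, he1⟩ := he'
  subst hp'
  have hc0 : 0 ≤ Real.cos ω' :=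
    Real.cos_nonneg_of_mem_Icc ⟨by linarith [hω'.1, Real.pi_pos], hω'.2⟩
  have hc1 : Real.cos ω' ≤ 1 := Real.cos_le_one _
  generalize hc : Real.cos ω' = c at *
  have hec0 : 0 ≤ e' * c := by positivity
  have hec : e' * c < 1 := by nlinarith
  have hp : 0 < q' * (1 + e') := by positivity
  have hm : 0 < 1 - e' * c := by linarith
  have hpl : 0 < 1 + e' * c := by linarith
  have hAle : q' * (1 + e') / (1 + e' * c) ≤ q' * (1 + e') / (1 - e' * c) :=
    div_le_div_of_nonneg_left hp.le hm (by linarith)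
  have hApos : 0 < q' * (1 + e') / (1 - e' * c) := by positivity
  have e1 : equot (q' * (1 + e')) (1 + e' * c)
      = ((q' * (1 + e') / (1 + e' * c) : ℝ) : EReal) := by
    rw [equot, if_neg hpl.ne']
  have e2 : equot (q' * (1 + e')) (1 - e' * c)
      = ((q' * (1 + e') / (1 - e' * c) : ℝ) : EReal) := by
    rw [equot, if_neg hm.ne']
  unfold deltaNod dplus dminus
  rw [hc, e1, e2]
  generalize q' * (1 + e') / (1 + e' * c) = A at *
  generalize q' * (1 + e') / (1 - e' * c) = B at *
  constructor
  · by_cases h : B ≤ q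
    · refine ⟨(0, 0), ⟨by simp, by simp [Real.pi_pos.le]⟩, ?_⟩
      have r1 : rplus q 0 0 = (q : EReal) := by simp [rplus, equot]
      have r2 : rminus q 0 0 = (q : EReal) := by simp [rminus, equot]
      simp only [r1, r2]
      norm_cast
      have i1 : A - q ≤ -(A - q) := by linarith
      have i2 : B - q ≤ -(B - q) := by linarith
      have i3 : -(B - q) ≤ -(A - q) := by linarith
      have i4 : 0 ≤ q - B := by linarith
      rw [max_eq_right (EReal.coe_le_coe_iff.2 i1), max_eq_right (EReal.coe_le_coe_iff.2 i2),
        min_eq_right (EReal.coe_le_coe_iff.2 i3), max_eq_right (EReal.coe_nonneg.2 i4), neg_sub]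
    · push Not at h
      have hx0 : 0 < 2 * q / B := by positivity
      have hx1 : 2 * q / B < 2 := by rw [div_lt_iff₀ hApos]; linarith
      refine ⟨(1, Real.arccos (1 - 2 * q / B)), ⟨by simp,
        ⟨Real.arccos_nonneg _, Real.arccos_le_pi _⟩⟩, ?_⟩
      have r2 : rminus q 1 (Real.arccos (1 - 2 * q / B)) = (B : EReal) := by
        rw [rminus, Real.cos_arccos (by linarith) (by linarith), equot, if_neg (by linarith)]
        congr 1
        have : (1 - 1 * (1 - 2 * q / B)) = 2 * q / B := by ring
        rw [this]
        field_simp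
        ring
      simp only [r2]
      have z : (B : EReal) - (B : EReal) = 0 := by norm_cast; simp
      rw [z, neg_zero, max_self, min_eq_right (abs_nonneg_aux _), max_eq_left]
      norm_cast
      linarith
  · rintro _ ⟨⟨e, ω⟩, ⟨⟨h0, h1⟩, -⟩, rfl⟩
    simp only at h0 h1 ⊢
    have k1 := Real.cos_le_one ω
    have k2 := Real.neg_one_le_cos ω
    refine max_le (le_min (abs_nonneg_aux _) (abs_nonneg_aux _)) (le_min ?_ ?_)
    · exact sub_ge_aux _ _ q _ (equot_ge_aux_s16 _ _ _ hq (by nlinarith) (by nlinarith)) (by linarith)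
    · exact sub_ge_aux _ _ q _ (equot_ge_aux_s16 _ _ _ hq (by nlinarith) (by nlinarith)) (by linarith)
end
end

section
/- Fix q' > 0 and e' ∈ (0,1), and let p' = q'(1+e'). For every (q,ω') with q > 0 and ω' ∈ [0,π/2], the maximum of the nodal distance δ_nod(q,e,ω,ω') over (e,ω) ∈ D₅ = [0,1] × [0,π] equals max{u^{ω'}_link(q,ω'), u^{ω'}_ext(q,ω')}, where u^{ω'}_link(q,ω') = p'/(1−e'·cos ω') − q and u^{ω'}_ext(q,ω') = 2q/(1+cos ω₊) − p'/(1+e'·cos ω'), with cos ω₊ = p'·e'·cos ω' / ( √( q²(1−e'²·cos²ω')² + (p'·e'·cos ω')² ) + q(1−e'²·cos²ω') ). -/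
open Real Set Filter Topology

noncomputable section

noncomputable def cosOmStar (p' e' q ω' : ℝ) : ℝ :=
  p' * e' * Real.cos ω' /
    (Real.sqrt (q ^ 2 * (1 - e' ^ 2 * Real.cos ω' ^ 2) ^ 2 + (p' * e' * Real.cos ω') ^ 2) +
      q * (1 - e' ^ 2 * Real.cos ω' ^ 2))

theorem aux_y (p k q : ℝ) (hp : 0 < p) (hk0 : 0 ≤ k) (hk1 : k < 1) (hq : 0 < q) (y : ℝ)
    (hy : y = p * k / (Real.sqrt (q ^ 2 * (1 - k ^ 2) ^ 2 + (p * k) ^ 2) + q * (1 - k ^ 2))) :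
    0 ≤ y ∧ y < 1 ∧ 2 * q / (1 + y) - p / (1 + k) = 2 * q / (1 - y) - p / (1 - k) := by
  have h1 : 0 < 1 - k ^ 2 := by nlinarith
  have ha : 0 < q * (1 - k ^ 2) := mul_pos hq h1
  have hb : 0 ≤ p * k := by positivity
  have hs : Real.sqrt (q ^ 2 * (1 - k ^ 2) ^ 2 + (p * k) ^ 2) ^ 2
      = q ^ 2 * (1 - k ^ 2) ^ 2 + (p * k) ^ 2 := Real.sq_sqrt (by positivity)
  have hs0 := Real.sqrt_nonneg (q ^ 2 * (1 - k ^ 2) ^ 2 + (p * k) ^ 2)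
  set s := Real.sqrt (q ^ 2 * (1 - k ^ 2) ^ 2 + (p * k) ^ 2) with hsd
  have hsb : p * k ≤ s := by
    refine Real.le_sqrt_of_sq_le ?_
    nlinarith [sq_nonneg (q * (1 - k ^ 2))]
  have hD : 0 < s + q * (1 - k ^ 2) := by linarith
  have y0 : 0 ≤ y := by rw [hy]; positivity
  have y1 : y < 1 := by rw [hy, div_lt_one hD]; linarith
  refine ⟨y0, y1, ?_⟩
  have hyD : y * (s + q * (1 - k ^ 2)) = p * k := by rw [hy]; field_simp
  have key : 2 * q * y * (1 - k ^ 2) = p * k * (1 - y ^ 2) := by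
    have : (s + q * (1 - k ^ 2)) ^ 2 * (2 * q * y * (1 - k ^ 2) - p * k * (1 - y ^ 2)) = 0 := by
      have e1 : (s + q * (1 - k ^ 2)) ^ 2 * (2 * q * y * (1 - k ^ 2) - p * k * (1 - y ^ 2))
        = 2 * (q * (1 - k ^ 2)) * (s + q * (1 - k ^ 2)) * (y * (s + q * (1 - k ^ 2)))
          - p * k * (s + q * (1 - k ^ 2)) ^ 2 + p * k * (y * (s + q * (1 - k ^ 2))) ^ 2 := by ring
      rw [e1, hyD]
      linear_combination (- p * k) * hs
    rcases mul_eq_zero.1 this with h | h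
    · exact absurd h (by positivity)
    · linarith
  have n1 : 1 + y ≠ 0 := by linarith
  have n2 : 1 - y ≠ 0 := by linarith
  have n3 : 1 + k ≠ 0 := by linarith
  have n4 : 1 - k ≠ 0 := by linarith
  have e2 : 2 * q / (1 - y) - 2 * q / (1 + y) = 4 * q * y / ((1 - y) * (1 + y)) := by
    field_simp; ring
  have e3 : p / (1 - k) - p / (1 + k) = 2 * p * k / ((1 - k) * (1 + k)) := by
    field_simp; ring
  have e4 : 4 * q * y / ((1 - y) * (1 + y)) = 2 * p * k / ((1 - k) * (1 + k)) := by
    rw [div_eq_div_iff (mul_ne_zero n2 n1) (mul_ne_zero n4 n3)]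
    linear_combination 2 * key
  linarith

theorem aux_cast (A r : ℝ) : max ((A : EReal) - r) (-((A : EReal) - r))
    = ((max (A - r) (r - A) : ℝ) : EReal) := by
  rw [← EReal.coe_sub, ← EReal.coe_neg, neg_sub]
  exact (EReal.coe_strictMono.monotone.map_max).symm

theorem aux_quot (a b : ℝ) (hb : b ≠ 0) : equot a b = ((a / b : ℝ) : EReal) := by
  simp [equot, hb]

/-- Optimal upper bound for `δ_nod` as a function of `(q, ω')`: the maximum over
`(e, ω) ∈ [0,1] × [0,π]` equals `max{u^{ω'}_link, u^{ω'}_ext}`, where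
`u^{ω'}_link = p'/(1 - e' cos ω') - q` and `u^{ω'}_ext = 2q/(1 + cos ω₊) - p'/(1 + e' cos ω')`. -/
theorem deltaNod_max_qomp (q' e' : ℝ) (hq' : 0 < q') (he' : e' ∈ Ioo (0 : ℝ) 1)
    (p' : ℝ) (hp' : p' = q' * (1 + e'))
    (q ω' : ℝ) (hq : 0 < q) (hω' : ω' ∈ Icc 0 (π / 2)) :
    IsGreatest ((fun pr : ℝ × ℝ => deltaNod q' e' q pr.1 pr.2 ω') '' (Icc 0 1 ×ˢ Icc 0 π))
      (((max (p' / (1 - e' * Real.cos ω') - q)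
          (2 * q / (1 + cosOmStar p' e' q ω') - p' / (1 + e' * Real.cos ω')) : ℝ) : EReal)) := by
  obtain ⟨he0, he1⟩ := he'
  have hc0 : 0 ≤ Real.cos ω' :=
    Real.cos_nonneg_of_mem_Icc ⟨by linarith [hω'.1, Real.pi_pos], hω'.2⟩
  have hc1 := Real.cos_le_one ω'
  have hp : 0 < p' := by rw [hp']; positivity
  unfold deltaNod dplus dminus rplus rminus
  rw [← hp']
  have hk0 : 0 ≤ e' * Real.cos ω' := by positivity
  have hk1 : e' * Real.cos ω' < 1 := by nlinarith
  have hyd : cosOmStar p' e' q ω' = p' * (e' * Real.cos ω') /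
      (Real.sqrt (q ^ 2 * (1 - (e' * Real.cos ω') ^ 2) ^ 2 + (p' * (e' * Real.cos ω')) ^ 2)
        + q * (1 - (e' * Real.cos ω') ^ 2)) := by
    unfold cosOmStar
    rw [mul_pow e' (Real.cos ω') 2, mul_assoc p' e' (Real.cos ω')]
  generalize cosOmStar p' e' q ω' = y at *
  generalize e' * Real.cos ω' = k at *
  obtain ⟨y0, y1, hy⟩ := aux_y p' k q hp hk0 hk1 hq y hyd
  rw [aux_quot p' (1 + k) (by linarith), aux_quot p' (1 - k) (by linarith)]
  have hAB : p' / (1 + k) ≤ p' / (1 - k) :=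
    div_le_div_of_nonneg_left hp.le (by linarith) (by linarith)
  generalize p' / (1 + k) = A at *
  generalize p' / (1 - k) = B at *
  have hqy : q ≤ 2 * q / (1 + y) := by
    rw [le_div_iff₀ (by linarith)]; nlinarith
  constructor
  · rcases le_total (2 * q / (1 + y) - A) (B - q) with h | h
    · rw [max_eq_left h]
      refine ⟨(1, π), ⟨⟨by norm_num, by norm_num⟩, ⟨Real.pi_pos.le, le_rfl⟩⟩, ?_⟩
      have h1 : equot (q * (1 + 1)) (1 + 1 * Real.cos π) = ⊤ := by simp [equot]
      have h2 : equot (q * (1 + 1)) (1 - 1 * Real.cos π) = (q : EReal) := by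
        rw [aux_quot _ _ (by simp)]
        congr 1
        rw [Real.cos_pi]; ring
      simp only [h1, h2]
      rw [aux_cast, EReal.sub_top, EReal.neg_bot, max_eq_right bot_le, min_eq_right le_top,
        max_eq_left (by linarith)]
    · rw [max_eq_right h]
      refine ⟨(1, Real.arccos y), ⟨⟨by norm_num, by norm_num⟩,
        ⟨Real.arccos_nonneg y, Real.arccos_le_pi y⟩⟩, ?_⟩
      simp only [Real.cos_arccos (by linarith : -1 ≤ y) y1.le]
      rw [aux_quot _ (1 + 1 * y) (by linarith), aux_quot _ (1 - 1 * y) (by linarith), aux_cast,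
        aux_cast, ← EReal.coe_strictMono.monotone.map_min]
      congr 1
      rw [show q * (1 + 1) / (1 + 1 * y) = 2 * q / (1 + y) by ring,
        show q * (1 + 1) / (1 - 1 * y) = 2 * q / (1 - y) by ring,
        max_eq_right (by linarith), max_eq_right (by linarith), ← hy, min_self]
  · rintro _ ⟨⟨e, ω⟩, ⟨⟨h0, h1⟩, -⟩, rfl⟩
    dsimp only at h0 h1 ⊢
    have x1 := Real.cos_le_one ω
    have x0 := Real.neg_one_le_cos ω
    generalize Real.cos ω = x at *
    rcases le_total y x with h | h
    · have hd : 0 < 1 + e * x := by nlinarith [mul_nonneg h0 (y0.trans h)]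
      refine (min_le_left _ _).trans ?_
      rw [aux_quot _ _ hd.ne', aux_cast, EReal.coe_le_coe_iff]
      have l1 : q ≤ q * (1 + e) / (1 + e * x) := by
        rw [le_div_iff₀ hd]
        exact mul_le_mul_of_nonneg_left (by nlinarith) hq.le
      have l2 : q * (1 + e) / (1 + e * x) ≤ 2 * q / (1 + y) := by
        rw [div_le_div_iff₀ hd (by linarith)]
        have : (1 + e) * (1 + y) ≤ 2 * (1 + e * x) := by
          nlinarith [mul_nonneg h0 (sub_nonneg.2 h), mul_nonneg (sub_nonneg.2 h1) (sub_nonneg.2 y1.le)]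
        nlinarith [mul_le_mul_of_nonneg_left this hq.le]
      exact max_le (le_max_of_le_left (by linarith)) (le_max_of_le_right (by linarith))
    · have hd : 0 < 1 - e * x := by
        nlinarith [mul_nonneg h0 (sub_nonneg.2 h), mul_nonneg (sub_nonneg.2 h1) y0]
      refine (min_le_right _ _).trans ?_
      rw [aux_quot _ _ hd.ne', aux_cast, EReal.coe_le_coe_iff]
      have l1 : q ≤ q * (1 + e) / (1 - e * x) := by
        rw [le_div_iff₀ hd]
        exact mul_le_mul_of_nonneg_left (by nlinarith) hq.le
      have l2 : q * (1 + e) / (1 - e * x) ≤ 2 * q / (1 - y) := by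
        rw [div_le_div_iff₀ hd (by linarith)]
        have : (1 + e) * (1 - y) ≤ 2 * (1 - e * x) := by
          nlinarith [mul_nonneg h0 (sub_nonneg.2 h), mul_nonneg (sub_nonneg.2 h1) y0]
        nlinarith [mul_le_mul_of_nonneg_left this hq.le]
      exact max_le (le_max_of_le_left (by linarith)) (le_max_of_le_right (by linarith))
end
end

section
/- Fix q' > 0 and e' ∈ (0,1), and let p' = q'(1+e'). For every (q,ω') with q > 0 and ω' ∈ [0,π/2], one has u^{ω'}_ext(q,ω') = 0 if and only if q = p'/2, where u^{ω'}_ext(q,ω') = 2q/(1+cos ω₊) − p'/(1+e'·cos ω') with cos ω₊ = p'·e'·cos ω' / ( √( q²(1−e'²·cos²ω')² + (p'·e'·cos ω')² ) + q(1−e'²·cos²ω') ). In particular, if q = p'/2 then cos ω₊ = e'·cos ω'. -/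
open Real Set

noncomputable section

/-- The upper bound `u^{ω'}_ext(q,ω') = 2q/(1 + cos ω₊) - p'/(1 + e' cos ω')`. -/
noncomputable def uExtOmp (p' e' q ω' : ℝ) : ℝ :=
  2 * q / (1 + cosOmStar p' e' q ω') - p' / (1 + e' * Real.cos ω')

/-- `u^{ω'}_ext(q,ω') = 0` if and only if `q = p'/2`; moreover when `q = p'/2` one has
`cos ω₊ = e' cos ω'`. -/
theorem uExtOmp_eq_zero_iff (q' e' : ℝ) (hq' : 0 < q') (he' : e' ∈ Ioo (0 : ℝ) 1)
    (p' : ℝ) (hp' : p' = q' * (1 + e'))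
    (q ω' : ℝ) (hq : 0 < q) (hω' : ω' ∈ Icc 0 (π / 2)) :
    (uExtOmp p' e' q ω' = 0 ↔ q = p' / 2) ∧
    (q = p' / 2 → cosOmStar p' e' q ω' = e' * Real.cos ω') := by
  obtain ⟨he0, he1⟩ := he'
  have hp : 0 < p' := by rw [hp']; positivity
  have hc0 : 0 ≤ Real.cos ω' :=
    Real.cos_nonneg_of_mem_Icc ⟨by linarith [hω'.1, Real.pi_pos], hω'.2⟩
  have hc1 : Real.cos ω' ≤ 1 := Real.cos_le_one _
  unfold uExtOmp
  have hx0 : 0 ≤ e' * Real.cos ω' := by positivity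
  have hx1 : e' * Real.cos ω' < 1 := by nlinarith
  have key : 0 ≤ cosOmStar p' e' q ω' ∧
      cosOmStar p' e' q ω' * (2 * q * (1 - (e' * Real.cos ω') ^ 2)
        + p' * (e' * Real.cos ω') * cosOmStar p' e' q ω') = p' * (e' * Real.cos ω') := by
    unfold cosOmStar
    rw [mul_assoc p', ← mul_pow e']
    generalize e' * Real.cos ω' = x at *
    have hA : 0 < 1 - x ^ 2 := by nlinarith
    have hS0 := Real.sqrt_nonneg (q ^ 2 * (1 - x ^ 2) ^ 2 + (p' * x) ^ 2)
    have hS := Real.sq_sqrt (show 0 ≤ q ^ 2 * (1 - x ^ 2) ^ 2 + (p' * x) ^ 2 by positivity)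
    generalize Real.sqrt (q ^ 2 * (1 - x ^ 2) ^ 2 + (p' * x) ^ 2) = S at *
    have hD : 0 < S + q * (1 - x ^ 2) := by positivity
    have h1 : p' * x / (S + q * (1 - x ^ 2)) * (S + q * (1 - x ^ 2)) = p' * x :=
      div_mul_cancel₀ _ hD.ne'
    have h0 : 0 ≤ p' * x / (S + q * (1 - x ^ 2)) := by positivity
    generalize p' * x / (S + q * (1 - x ^ 2)) = c at *
    refine ⟨h0, ?_⟩
    have h2 : S - q * (1 - x ^ 2) = p' * x * c := by
      apply mul_right_cancel₀ hD.ne'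
      linear_combination hS - p' * x * h1
    linear_combination h1 - c * h2
  obtain ⟨k0, k⟩ := key
  generalize cosOmStar p' e' q ω' = c at *
  generalize e' * Real.cos ω' = x at *
  have back : q = p' / 2 → c = x := by
    intro h
    subst h
    have h3 : p' * (x * c + 1) * (c - x) = 0 := by linear_combination k
    have h4 : p' * (x * c + 1) ≠ 0 := by positivity
    linarith [(mul_eq_zero.mp h3).resolve_left h4]
  refine ⟨⟨fun h => ?_, fun h => ?_⟩, back⟩
  · rw [sub_eq_zero, div_eq_div_iff (by positivity) (by positivity)] at h
    have h3 : p' * (1 + c) * (c - x) = 0 := by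
      linear_combination k - c * (1 - x) * h
    have h4 : p' * (1 + c) ≠ 0 := by positivity
    have h5 : c = x := by linarith [(mul_eq_zero.mp h3).resolve_left h4]
    subst h5
    have := mul_right_cancel₀ (show (1 + c) ≠ 0 by positivity) h
    linarith
  · rw [back h, h]
    ring
end
end

section
/- Fix q' > 0 and take e' = 0 (circular trajectory A'). For every (q,ω) with q > 0 and ω ∈ [0,π/2], the minimum of the nodal distance δ_nod(q,e,ω,·) over e ∈ [0,1] equals max{0, q' − 2q/(1−cos ω), q − q'} (the term q' − 2q/(1−cos ω) interpreted as −∞ when ω = 0), and the maximum of δ_nod(q,e,ω,·) over e ∈ [0,1] equals max{q' − q, 2q/(1+cos ω) − q'}. -/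
open Real Set Filter Topology

noncomputable section

lemma equot_one (q' x : ℝ) : equot (q' * (1 + 0)) (1 + 0 * x) = (q' : EReal) := by
  simp [equot]

lemma equot_one' (q' x : ℝ) : equot (q' * (1 + 0)) (1 - 0 * x) = (q' : EReal) := by
  simp [equot]

lemma emax_abs (a b : ℝ) : max ((a : EReal) - (b : EReal)) (-((a : EReal) - (b : EReal)))
    = ((|a - b| : ℝ) : EReal) := by
  rw [← EReal.coe_sub, ← EReal.coe_neg, abs_eq_max_neg]
  exact (EReal.coe_strictMono.monotone.map_max).symm

lemma delta_fin (q' q e ω ω' : ℝ) (h1 : 1 + e * Real.cos ω ≠ 0) (h2 : 1 - e * Real.cos ω ≠ 0) :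
    deltaNod q' 0 q e ω ω' = ((min |q' - q * (1 + e) / (1 + e * Real.cos ω)|
      |q' - q * (1 + e) / (1 - e * Real.cos ω)| : ℝ) : EReal) := by
  unfold deltaNod dplus dminus rplus rminus
  rw [equot_one, equot_one', equot, equot, if_neg h1, if_neg h2, emax_abs, emax_abs]
  exact (EReal.coe_strictMono.monotone.map_min).symm

lemma delta_inf (q' q e ω ω' : ℝ) (h1 : 1 + e * Real.cos ω ≠ 0) (h2 : 1 - e * Real.cos ω = 0) :
    deltaNod q' 0 q e ω ω' = ((|q' - q * (1 + e) / (1 + e * Real.cos ω)| : ℝ) : EReal) := by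
  unfold deltaNod dplus dminus rplus rminus
  rw [equot_one, equot_one', equot, equot, if_neg h1, if_pos h2, emax_abs]
  simp

/-- Case `e' = 0` (circular trajectory `A'`): for every `(q, ω)` with `q > 0`,
`ω ∈ [0,π/2]` (and any `ω'`, on which nothing depends), the minimum of `δ_nod` over
`e ∈ [0,1]` equals `max{0, q' - 2q/(1-cos ω), q - q'}` (the middle term being `-∞` at `ω = 0`),
and the maximum equals `max{q' - q, 2q/(1+cos ω) - q'}`. -/
theorem deltaNod_min_max_qom_circular (q' : ℝ) (hq' : 0 < q')
    (q ω : ℝ) (hq : 0 < q) (hω : ω ∈ Icc 0 (π / 2)) (ω' : ℝ) :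
    IsLeast ((fun e => deltaNod q' 0 q e ω ω') '' (Icc (0 : ℝ) 1))
      (max 0 (max ((q' : EReal) - equot (2 * q) (1 - Real.cos ω))
        (((q - q' : ℝ) : EReal)))) ∧
    IsGreatest ((fun e => deltaNod q' 0 q e ω ω') '' (Icc (0 : ℝ) 1))
      (((max (q' - q) (2 * q / (1 + Real.cos ω) - q') : ℝ) : EReal)) := by
  have hc0 : 0 ≤ Real.cos ω := Real.cos_nonneg_of_mem_Icc ⟨by linarith [hω.1, Real.pi_pos], hω.2⟩
  have hc1 : Real.cos ω ≤ 1 := Real.cos_le_one ω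
  have F := fun e => delta_fin q' q e ω ω'
  have I := fun e => delta_inf q' q e ω ω'
  generalize Real.cos ω = c at *
  have P : ∀ e ∈ Icc (0 : ℝ) 1, 0 < 1 + e * c := fun e he => by
    have := mul_nonneg he.1 hc0
    linarith
  have N : ∀ e ∈ Icc (0 : ℝ) 1, 0 ≤ 1 - e * c := fun e he => by
    nlinarith [he.1, he.2]
  have rp1 : ∀ e ∈ Icc (0 : ℝ) 1, q ≤ q * (1 + e) / (1 + e * c) := fun e he => by
    rw [le_div_iff₀ (P e he)]
    have : e * c ≤ e := by nlinarith [he.1]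
    nlinarith
  have rp2 : ∀ e ∈ Icc (0 : ℝ) 1, q * (1 + e) / (1 + e * c) ≤ 2 * q / (1 + c) := fun e he => by
    rw [div_le_div_iff₀ (P e he) (by linarith)]
    have : 0 ≤ (1 - e) * (1 - c) := mul_nonneg (by linarith [he.2]) (by linarith)
    nlinarith
  have rpm : ∀ e ∈ Icc (0 : ℝ) 1, 1 - e * c ≠ 0 →
      q * (1 + e) / (1 + e * c) ≤ q * (1 + e) / (1 - e * c) := fun e he h => by
    have h' := lt_of_le_of_ne (N e he) h.symm
    apply div_le_div_of_nonneg_left _ h'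
    · have := mul_nonneg he.1 hc0
      linarith
    · have := he.1
      positivity
  have rm2 : ∀ e ∈ Icc (0 : ℝ) 1, 1 - e * c ≠ 0 → 1 - c ≠ 0 →
      q * (1 + e) / (1 - e * c) ≤ 2 * q / (1 - c) := fun e he h hc => by
    have h' := lt_of_le_of_ne (N e he) h.symm
    have hc' := lt_of_le_of_ne (by linarith : 0 ≤ 1 - c) hc.symm
    rw [div_le_div_iff₀ h' hc']
    have : 0 ≤ (1 - e) * (1 + c) := mul_nonneg (by linarith [he.2]) (by linarith)
    nlinarith
  have m0 : (0 : ℝ) ∈ Icc (0 : ℝ) 1 := by simp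
  have m1 : (1 : ℝ) ∈ Icc (0 : ℝ) 1 := by simp
  have D0 : deltaNod q' 0 q 0 ω ω' = ((|q' - q| : ℝ) : EReal) := by
    rw [F 0 (by simp) (by simp)]; simp
  have r1 : q ≤ 2 * q / (1 + c) := (rp1 1 m1).trans (rp2 1 m1)
  refine ⟨?_, ?_⟩
  · have hM : ∃ m : ℝ, (max 0 (max ((q' : EReal) - equot (2 * q) (1 - c))
        (((q - q' : ℝ) : EReal)))) = (m : EReal) ∧
        ((1 - c = 0 ∧ m = max 0 (q - q')) ∨
          (1 - c ≠ 0 ∧ m = max 0 (max (q' - 2 * q / (1 - c)) (q - q')))) := by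
      by_cases h : 1 - c = 0
      · refine ⟨max 0 (q - q'), ?_, Or.inl ⟨h, rfl⟩⟩
        rw [equot, if_pos h, show (q' : EReal) - ⊤ = ⊥ from EReal.sub_top _, max_eq_right bot_le]
        exact (EReal.coe_strictMono.monotone.map_max).symm
      · refine ⟨max 0 (max (q' - 2 * q / (1 - c)) (q - q')), ?_, Or.inr ⟨h, rfl⟩⟩
        rw [equot, if_neg h, ← EReal.coe_sub, EReal.coe_strictMono.monotone.map_max,
          EReal.coe_strictMono.monotone.map_max]
        rfl
    obtain ⟨m, hm, hm'⟩ := hM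
    rw [hm]
    constructor
    · rcases le_or_gt q' q with h | h
      · refine ⟨0, m0, ?_⟩
        simp only [D0]
        congr 1
        rw [abs_of_nonpos (by linarith)]
        rcases hm' with ⟨_, rfl⟩ | ⟨hc, rfl⟩
        · rw [max_eq_right] <;> linarith
        · have := (rp1 1 m1).trans ((rpm 1 m1 (by simpa using hc)).trans
            (rm2 1 m1 (by simpa using hc) hc))
          rw [max_eq_right (b := q - q'), max_eq_right] <;> linarith
      · rcases le_or_gt (q' * (1 - c)) (2 * q) with h2 | h2
        · have hd : 0 < q + q' * c := by positivity
          have he : (q' - q) / (q + q' * c) ∈ Icc (0 : ℝ) 1 := by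
            constructor
            · exact div_nonneg (by linarith) hd.le
            · rw [div_le_one hd]; linarith
          refine ⟨_, he, ?_⟩
          have hm0 : m = 0 := by
            rcases hm' with ⟨_, rfl⟩ | ⟨hc, rfl⟩
            · rw [max_eq_left]; linarith
            · have hc' := lt_of_le_of_ne (by linarith : 0 ≤ 1 - c) hc.symm
              rw [max_eq_left]
              apply max_le
              · rw [sub_nonpos, le_div_iff₀ hc']; exact h2
              · linarith
          have hk : q * (1 + (q' - q) / (q + q' * c)) = q' * (1 - (q' - q) / (q + q' * c) * c) := by
            field_simp; ring
          have hn : 1 - (q' - q) / (q + q' * c) * c ≠ 0 := by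
            intro h0
            rw [h0, mul_zero] at hk
            have := he.1
            have : 0 < q * (1 + (q' - q) / (q + q' * c)) := by positivity
            linarith
          simp only [F _ (P _ he).ne' hn]
          congr 1
          rw [hm0]
          have : q * (1 + (q' - q) / (q + q' * c)) / (1 - (q' - q) / (q + q' * c) * c) = q' := by
            rw [hk, mul_div_assoc, div_self hn, mul_one]
          rw [this, sub_self, abs_zero]
          exact min_eq_right (abs_nonneg _)
        · refine ⟨1, m1, ?_⟩
          have hc : 1 - c ≠ 0 := by
            intro h0
            rw [h0] at h2
            linarith
          have hc' := lt_of_le_of_ne (by linarith : 0 ≤ 1 - c) hc.symm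
          simp only [F 1 (P 1 m1).ne' (by simpa using hc)]
          congr 1
          have a1 := rpm 1 m1 (by simpa using hc)
          have a2 : q * (1 + 1) / (1 - 1 * c) = 2 * q / (1 - c) := by ring_nf
          have a3 : 2 * q / (1 - c) < q' := by rw [div_lt_iff₀ hc']; exact h2
          rw [a2] at a1 ⊢
          rcases hm' with ⟨h0, _⟩ | ⟨_, rfl⟩
          · exact absurd h0 hc
          · rw [abs_of_nonneg (by linarith), abs_of_nonneg (by linarith), min_eq_right (by linarith),
              max_eq_left (b := q - q') (by linarith), max_eq_right (by linarith)]
    · rintro _ ⟨e, he, rfl⟩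
      have a1 := rp1 e he
      by_cases hn : 1 - e * c = 0
      · simp only [I e (P e he).ne' hn]
        rw [EReal.coe_le_coe_iff]
        have hc : 1 - c = 0 := by
          have : e * c ≤ c := by nlinarith [he.2]
          linarith
        rcases hm' with ⟨_, rfl⟩ | ⟨h0, _⟩
        · refine max_le (abs_nonneg _) ?_
          rw [abs_sub_comm]
          exact le_trans (by linarith) (le_abs_self _)
        · exact absurd hc h0
      · simp only [F e (P e he).ne' hn]
        rw [EReal.coe_le_coe_iff]
        have a2 := rpm e he hn
        have b1 := neg_le_abs (q' - q * (1 + e) / (1 + e * c))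
        have b2 := neg_le_abs (q' - q * (1 + e) / (1 - e * c))
        have b3 := le_abs_self (q' - q * (1 + e) / (1 + e * c))
        have b4 := le_abs_self (q' - q * (1 + e) / (1 - e * c))
        rcases hm' with ⟨_, rfl⟩ | ⟨hc, rfl⟩
        · exact max_le (le_min (abs_nonneg _) (abs_nonneg _))
            (le_min (by linarith) (by linarith))
        · have a3 := rm2 e he hn hc
          exact max_le (le_min (abs_nonneg _) (abs_nonneg _))
            (max_le (le_min (by linarith) (by linarith)) (le_min (by linarith) (by linarith)))
  · constructor
    · rcases le_total (2 * q / (1 + c) - q') (q' - q) with h | h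
      · refine ⟨0, m0, ?_⟩
        simp only [D0]
        rw [max_eq_left h, abs_of_nonneg (by linarith)]
      · refine ⟨1, m1, ?_⟩
        have a2 : q * (1 + 1) / (1 + 1 * c) = 2 * q / (1 + c) := by ring_nf
        rw [max_eq_right h]
        by_cases hn : 1 - 1 * c = 0
        · simp only [I 1 (P 1 m1).ne' hn]
          rw [a2, abs_of_nonpos (by linarith), neg_sub]
        · simp only [F 1 (P 1 m1).ne' hn]
          have a1 := rpm 1 m1 hn
          rw [a2] at a1 ⊢
          rw [abs_of_nonpos (by linarith), abs_of_nonpos (by linarith), min_eq_left (by linarith),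
            neg_sub]
    · rintro _ ⟨e, he, rfl⟩
      have a1 := rp1 e he
      have a2 := rp2 e he
      have key : |q' - q * (1 + e) / (1 + e * c)| ≤ max (q' - q) (2 * q / (1 + c) - q') := by
        rw [abs_eq_max_neg]
        exact max_le_max (by linarith) (by linarith)
      by_cases hn : 1 - e * c = 0
      · simp only [I e (P e he).ne' hn]
        exact EReal.coe_le_coe_iff.2 key
      · simp only [F e (P e he).ne' hn]
        exact EReal.coe_le_coe_iff.2 ((min_le_left _ _).trans key)
end
end
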